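/- arXiv:1003.4117 — 3 statements merged into one kernel-verified Lean document; each statement's English description precedes it below -/
import Mathlib

section
/- Fix s ∈ [0,T] and a Borel probability measure ζ on H. Let K ⊂ M_{s,ζ} be a convex set of measures such that for every μ ∈ K the set L₀(D(L₀)) = {L₀u : u ∈ E_A([0,T]×H)} is dense in L¹([s,T]×H, μ). Then K contains at most one element. -/
open MeasureTheory Set Filter Topology
open scoped InnerProductSpace ENNReal NNReal

attribute [local instance] Classical.propDecidable

noncomputable section

variable (H : Type) [NormedAddCommGroup H] [InnerProductSpace ℝ H] [CompleteSpace H]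
  [SecondCountableTopology H] [MeasurableSpace H] [BorelSpace H]

/-- All data of the framework: the `C₀`-semigroup `e^{tA}` with its generator `A`
(a densely defined unbounded operator), the diffusion operator `C` (symmetric, nonnegative)
with a square root `C^{1/2}`, a Hilbert basis of `H`, the time horizon `T > 0`, and the
Borel measurable drift `F` defined on a Borel set `DF ⊆ [0,T] × H`. -/
structure FPData where
  T : ℝ
  hT : 0 < T
  S : ℝ → H →L[ℝ] H
  S_zero : S 0 = 1
  S_add : ∀ s t : ℝ, 0 ≤ s → 0 ≤ t → S (s + t) = (S s).comp (S t)
  S_cont : ∀ x : H, ContinuousOn (fun t => S t x) (Ici (0 : ℝ))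
  A : H →ₗ.[ℝ] H
  A_dense : Dense (A.domain : Set H)
  A_mem_iff : ∀ x : H, x ∈ A.domain ↔
    ∃ y : H, Tendsto (fun t : ℝ => t⁻¹ • (S t x - x)) (𝓝[>] 0) (𝓝 y)
  A_gen : ∀ x : A.domain,
    Tendsto (fun t : ℝ => t⁻¹ • (S t (x : H) - (x : H))) (𝓝[>] 0) (𝓝 (A x))
  C : H →L[ℝ] H
  C_pos : C.IsPositive
  sqrtC : H →L[ℝ] H
  sqrtC_pos : sqrtC.IsPositive
  sqrtC_sq : sqrtC.comp sqrtC = C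
  ι : Type
  basis : HilbertBasis ι ℝ H
  F : ℝ × H → H
  DF : Set (ℝ × H)
  DF_meas : MeasurableSet DF
  F_meas : Measurable F

variable {H}

/-- The spatial gradient `D_x u(t,x)` of a function `u : ℝ × H → ℝ`. -/
def xGrad (u : ℝ × H → ℝ) (p : ℝ × H) : H :=
  gradient (fun z => u (p.1, z)) p.2

/-- The set `Sf` of functions is dense in `L¹([s,T] × H, μ)`. -/
def DenseRangeL1 (μ : Measure (ℝ × H)) (Sf : Set (ℝ × H → ℝ)) : Prop :=
  ∀ f : ℝ × H → ℝ, Integrable f μ → ∀ ε > 0,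
    ∃ g ∈ Sf, Integrable g μ ∧ ∫ p, |f p - g p| ∂μ < ε

namespace FPData

variable (D : FPData H)

/-- `h ∈ C¹([0,T]; D(A*))`, represented by the pair `(h, g)` with `g t = A* (h t)`. -/
def CinDAstar (h g : ℝ → H) : Prop :=
  ContDiffOn ℝ 1 h (Icc 0 D.T) ∧ ContDiffOn ℝ 1 g (Icc 0 D.T) ∧
    ∀ t ∈ Icc 0 D.T, (h t, g t) ∈ D.A.adjoint.graph

/-- Generators of `E_A([0,T] × H)`: real parts of `φ(t) e^{i⟨x, h(t)⟩}`. -/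
def EAgen : Set (ℝ × H → ℝ) :=
  {u | ∃ (φ : ℝ → ℝ) (h g : ℝ → H), ContDiffOn ℝ 1 φ (Icc 0 D.T) ∧ φ D.T = 0 ∧
    D.CinDAstar h g ∧
    (u = (fun p => φ p.1 * Real.cos ⟪p.2, h p.1⟫_ℝ) ∨
     u = (fun p => φ p.1 * Real.sin ⟪p.2, h p.1⟫_ℝ))}

/-- The space of test functions `E_A([0,T] × H) = D(L₀)`: the linear span of the generators. -/
def EA : Set (ℝ × H → ℝ) := ↑(Submodule.span ℝ D.EAgen)

/-- The trace term `Tr[C D²_x u(t,x)] = Σ_i ⟨D²_x u(t,x)(C^{1/2} e_i), C^{1/2} e_i⟩`. -/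
def traceCD2 (u : ℝ × H → ℝ) (p : ℝ × H) : ℝ :=
  ∑' i : D.ι,
    ⟪(fderiv ℝ (gradient fun z => u (p.1, z)) p.2) (D.sqrtC (D.basis i)),
      D.sqrtC (D.basis i)⟫_ℝ

/-- The Ornstein–Uhlenbeck part `V₀u = D_t u + (1/2)Tr[C D²_x u] + ⟨x, A* D_x u⟩`
of the Kolmogorov operator. -/
def Vzero (u : ℝ × H → ℝ) (p : ℝ × H) : ℝ :=
  deriv (fun r => u (r, p.2)) p.1 + (1 / 2) * D.traceCD2 u p +
    (if hk : xGrad u p ∈ D.A.adjoint.domain then ⟪p.2, D.A.adjoint ⟨xGrad u p, hk⟩⟫_ℝ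
     else 0)

/-- The Kolmogorov operator `L₀u = V₀u + ⟨F(t,x), D_x u⟩`. -/
def Lzero (u : ℝ × H → ℝ) (p : ℝ × H) : ℝ :=
  D.Vzero u p + ⟪D.F p, xGrad u p⟫_ℝ

/-- `|F(t,x)|`, with the convention `|F(t,x)| = +∞` outside `D(F)`. -/
def FnormE (p : ℝ × H) : ℝ≥0∞ := if p ∈ D.DF then (‖D.F p‖₊ : ℝ≥0∞) else ⊤

/-- Condition (1.6): `∫ (|⟨y, A*h(t)⟩| + |F(t,y)|) dμ < ∞` for all `h ∈ C¹([0,T]; D(A*))`. -/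
def DriftIntegrable (μ : Measure (ℝ × H)) : Prop :=
  ∀ h g : ℝ → H, D.CinDAstar h g →
    ∫⁻ p, ((‖⟪p.2, g p.1⟫_ℝ‖₊ : ℝ≥0∞) + D.FnormE p) ∂μ < ⊤

/-- `μ(dt,dx) = μ_t(dx) dt` on `[s,T] × H` for a measurable kernel `(μ_t)`. -/
def IsKernel (s : ℝ) (μ : Measure (ℝ × H)) (μt : ℝ → Measure H) : Prop :=
  (∀ B : Set H, MeasurableSet B → Measurable fun t => μt t B) ∧
  ∀ E : Set (ℝ × H), MeasurableSet E → μ E = ∫⁻ t in Icc s D.T, μt t {x | (t, x) ∈ E}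

/-- `μ = μ_t dt` is a solution of the Fokker–Planck equation (1.5) with initial condition
`ζ` at time `s` (membership in `M_{s,ζ}`). -/
def IsFPSol (s : ℝ) (ζ : Measure H) (μ : Measure (ℝ × H)) (μt : ℝ → Measure H) : Prop :=
  (∀ t ∈ Icc s D.T, IsProbabilityMeasure (μt t)) ∧
  D.IsKernel s μ μt ∧ D.DriftIntegrable μ ∧
  ∀ u ∈ D.EA, ∀ᵐ t ∂(volume.restrict (Icc s D.T)),
    ∫ y, u (t, y) ∂(μt t) =
      ∫ y, u (s, y) ∂ζ + ∫ r in Icc s t, (∫ y, D.Lzero u (r, y) ∂(μt r))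

/-- The set `M_{s,ζ}` of solutions of the Fokker–Planck equation. -/
def Mset (s : ℝ) (ζ : Measure H) : Set (Measure (ℝ × H)) :=
  {μ | ∃ μt : ℝ → Measure H, D.IsFPSol s ζ μ μt}

/-- Membership in `M_s^λ` (formula (4.2)): `ν = ν_t dt` is a finite nonnegative measure with
`∫ L₀ u dν ≤ 2λ ∫ u dν` for all nonnegative `u ∈ E_A`. -/
def IsSubInv (lam s : ℝ) (ν : Measure (ℝ × H)) (νt : ℝ → Measure H) : Prop :=
  (∀ t ∈ Icc s D.T, IsFiniteMeasure (νt t)) ∧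
  D.IsKernel s ν νt ∧ D.DriftIntegrable ν ∧
  ∀ u ∈ D.EA, (∀ p : ℝ × H, p.1 ∈ Icc 0 D.T → 0 ≤ u p) →
    ∫ t in Icc s D.T, (∫ y, D.Lzero u (t, y) ∂(νt t)) ≤
      2 * lam * ∫ t in Icc s D.T, (∫ y, u (t, y) ∂(νt t))

/-- The moment condition `∫_s^T ∫_H (|x|⁴ + |F(t,x)|² + |x|⁴|F(t,x)|²) ν_t(dx) dt < ∞`. -/
def moment2 (s : ℝ) (νt : ℝ → Measure H) : Prop :=
  ∫⁻ t in Icc s D.T, (∫⁻ y, (ENNReal.ofReal (‖y‖ ^ 4) + (D.FnormE (t, y)) ^ 2 +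
    ENNReal.ofReal (‖y‖ ^ 4) * (D.FnormE (t, y)) ^ 2) ∂(νt t)) < ⊤

/-- The moment condition `∫_s^T ∫_H (|x|² + |F(t,x)| + |x|²|F(t,x)|) ν_t(dx) dt < ∞`. -/
def moment1 (s : ℝ) (νt : ℝ → Measure H) : Prop :=
  ∫⁻ t in Icc s D.T, (∫⁻ y, (ENNReal.ofReal (‖y‖ ^ 2) + D.FnormE (t, y) +
    ENNReal.ofReal (‖y‖ ^ 2) * D.FnormE (t, y)) ∂(νt t)) < ⊤

/-- Hypothesis 3.1: dissipativity of `A`, trace class `Q_t = ∫_0^t e^{sA} C e^{sA*} ds`,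
and the smoothing condition `e^{tA}(H) ⊆ Q_t^{1/2}(H)` with `Λ_t := (Q_t^{1/2})^{-1} e^{tA}`
satisfying `∫_0^∞ e^{-λt} ‖Λ_t‖ dt < ∞` for `λ` large enough. -/
structure Hyp31 where
  ω : ℝ
  A_diss : ∀ x : D.A.domain, ⟪D.A x, (x : H)⟫_ℝ ≤ ω * ‖(x : H)‖ ^ 2
  Q : ℝ → H →L[ℝ] H
  Q_def : ∀ t : ℝ, 0 < t → ∀ x : H,
    Q t x = ∫ r in (0 : ℝ)..t, D.S r (D.C ((ContinuousLinearMap.adjoint (D.S r)) x))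
  Q_pos : ∀ t : ℝ, 0 < t → (Q t).IsPositive
  Q_traceClass : ∀ t : ℝ, 0 < t → Summable fun i : D.ι => ⟪Q t (D.basis i), D.basis i⟫_ℝ
  sqrtQ : ℝ → H →L[ℝ] H
  sqrtQ_pos : ∀ t : ℝ, 0 < t → (sqrtQ t).IsPositive
  sqrtQ_sq : ∀ t : ℝ, 0 < t → (sqrtQ t).comp (sqrtQ t) = Q t
  range_incl : ∀ t : ℝ, 0 < t → Set.range (D.S t) ⊆ Set.range (sqrtQ t)
  Λ : ℝ → H →L[ℝ] H
  Λ_spec : ∀ t : ℝ, 0 < t → (sqrtQ t).comp (Λ t) = D.S t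
  lam₀ : ℝ
  Λ_int : ∀ lam : ℝ, lam₀ ≤ lam →
    IntegrableOn (fun t => Real.exp (-lam * t) * ‖Λ t‖) (Ioi 0)

/-- Hypothesis 5.1: `F(t,·)` is the minimal section of an `m`-dissipative graph
`F̄(t,·)`, with `F(t,0) = 0`. -/
structure Hyp51 where
  Fbar : ℝ → H → Set H
  dom_meas : ∀ t ∈ Icc 0 D.T, MeasurableSet {x : H | (Fbar t x).Nonempty}
  K : ℝ
  K_pos : 0 < K
  diss : ∀ t ∈ Icc 0 D.T, ∀ x y u v : H, u ∈ Fbar t x → v ∈ Fbar t y →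
    ⟪u - v, x - y⟫_ℝ ≤ K * ‖x - y‖ ^ 2
  mrange : ∀ t ∈ Icc 0 D.T, ∀ lam : ℝ, K < lam → ∀ z : H,
    ∃ x : H, ∃ w ∈ Fbar t x, lam • x - w = z
  dom_eq : ∀ t ∈ Icc 0 D.T, ∀ x : H, (t, x) ∈ D.DF ↔ (Fbar t x).Nonempty
  minimal : ∀ t ∈ Icc 0 D.T, ∀ x : H, (t, x) ∈ D.DF →
    D.F (t, x) ∈ Fbar t x ∧ ∀ w ∈ Fbar t x, ‖D.F (t, x)‖ ≤ ‖w‖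
  zero_mem : ∀ t ∈ Icc 0 D.T, (t, (0 : H)) ∈ D.DF ∧ D.F (t, 0) = 0

/-- Hypothesis 3.3 for a drift `F₀ : [0,T] × H → H`: continuity, continuous space
derivative, and uniform Lipschitz continuity in the space variable. -/
def Hyp33 (F0 : ℝ × H → H) : Prop :=
  ContinuousOn F0 (Icc 0 D.T ×ˢ (univ : Set H)) ∧
  (∀ t ∈ Icc 0 D.T, ∀ x : H, DifferentiableAt ℝ (fun y => F0 (t, y)) x) ∧
  (∀ t ∈ Icc 0 D.T, Continuous fun x : H => fderiv ℝ (fun y => F0 (t, y)) x) ∧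
  ∃ K > 0, ∀ t ∈ Icc 0 D.T, ∀ x y : H, ‖F0 (t, x) - F0 (t, y)‖ ≤ K * ‖x - y‖

/-- The data of the Ornstein–Uhlenbeck semigroup: the Gaussian measures `N_{Q_t}`
(specified through their characteristic functionals). -/
structure OUData (hyp : D.Hyp31) where
  N : ℝ → Measure H
  N_prob : ∀ t : ℝ, 0 ≤ t → IsProbabilityMeasure (N t)
  N_zero : N 0 = Measure.dirac 0
  N_char : ∀ t : ℝ, 0 < t → ∀ h : H,
    ∫ x, Complex.exp ((⟪x, h⟫_ℝ : ℂ) * Complex.I) ∂(N t) =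
      Complex.exp (-((⟪hyp.Q t h, h⟫_ℝ : ℂ)) / 2)

end FPData

namespace FPData.OUData

variable {H : Type} [NormedAddCommGroup H] [InnerProductSpace ℝ H] [CompleteSpace H]
  [SecondCountableTopology H] [MeasurableSpace H] [BorelSpace H]
  {D : FPData H} {hyp : D.Hyp31}

/-- The Ornstein–Uhlenbeck semigroup `R_t φ(x) = ∫_H φ(e^{tA} x + y) N_{Q_t}(dy)`. -/
def Rop (O : D.OUData hyp) (t : ℝ) (φ : H → ℝ) (x : H) : ℝ :=
  ∫ y, φ (D.S t x + y) ∂(O.N t)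

/-- The resolvent `G̃_λ f(x) = ∫_0^∞ e^{-λt} R_t f(x) dt` of the OU semigroup. -/
def Gtilde (O : D.OUData hyp) (lam : ℝ) (f : H → ℝ) (x : H) : ℝ :=
  ∫ t in Ioi (0 : ℝ), Real.exp (-lam * t) * O.Rop t f x

/-- The resolvent `G_λ f(t,x) = ∫_t^T e^{-λ(r-t)} R_{r-t} f(r,·)(x) dr` of the
time-dependent OU operator `V`; by definition `u ∈ D(V)` iff `u = G_λ f` for some `λ` and
some `f ∈ C([0,T]; C_{u,2}(H))`, and then `Vu = λu - f`. -/
def Gop (O : D.OUData hyp) (lam : ℝ) (f : ℝ → H → ℝ) (p : ℝ × H) : ℝ :=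
  ∫ r in p.1..D.T, Real.exp (-lam * (r - p.1)) * O.Rop (r - p.1) (f r) p.2

end FPData.OUData

section Spaces

variable {H : Type} [NormedAddCommGroup H] [InnerProductSpace ℝ H] [CompleteSpace H]

/-- Membership in `C_{u,2}(H)`: `x ↦ φ(x)/(1+|x|²)` is uniformly continuous and bounded. -/
def MemCu2 (φ : H → ℝ) : Prop :=
  UniformContinuous (fun x : H => φ x / (1 + ‖x‖ ^ 2)) ∧
    ∃ M : ℝ, ∀ x : H, |φ x| ≤ M * (1 + ‖x‖ ^ 2)

/-- The norm of `C_{u,2}(H)`: `‖φ‖ = sup_x |φ(x)|/(1+|x|²)`. -/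
def cu2Norm (φ : H → ℝ) : ℝ := ⨆ x : H, |φ x| / (1 + ‖x‖ ^ 2)

/-- The sup norm `‖f‖_∞ = sup_x |f(x)|`. -/
def supNorm (f : H → ℝ) : ℝ := ⨆ x : H, |f x|

/-- Membership in `C¹_u(H)`: bounded and uniformly continuous together with the
(Fréchet) derivative. -/
def MemC1u (φ : H → ℝ) : Prop :=
  UniformContinuous φ ∧ (∃ M : ℝ, ∀ x : H, |φ x| ≤ M) ∧ Differentiable ℝ φ ∧
    UniformContinuous (gradient φ) ∧ ∃ M : ℝ, ∀ x : H, ‖gradient φ x‖ ≤ M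

/-- Membership in `C_u(H,H)`: bounded and uniformly continuous `H → H`. -/
def MemCuHH (Φ : H → H) : Prop := UniformContinuous Φ ∧ ∃ M : ℝ, ∀ x : H, ‖Φ x‖ ≤ M

end Spaces

namespace FPData

variable {H : Type} [NormedAddCommGroup H] [InnerProductSpace ℝ H] [CompleteSpace H]
  [SecondCountableTopology H] [MeasurableSpace H] [BorelSpace H] (D : FPData H)

/-- Membership in `C([0,T]; C_{u,2}(H))`. -/
def MemCT (f : ℝ → H → ℝ) : Prop :=
  (∀ t ∈ Icc 0 D.T, MemCu2 (f t)) ∧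
  ∀ t₀ ∈ Icc 0 D.T, ∀ ε > 0, ∃ δ > 0, ∀ t ∈ Icc 0 D.T, |t - t₀| < δ →
    ∀ x : H, |f t x - f t₀ x| ≤ ε * (1 + ‖x‖ ^ 2)

/-- Membership in `C([0,T]; C¹_u(H))`. -/
def MemCTC1u (f : ℝ → H → ℝ) : Prop :=
  (∀ t ∈ Icc 0 D.T, MemC1u (f t)) ∧
  ∀ t₀ ∈ Icc 0 D.T, ∀ ε > 0, ∃ δ > 0, ∀ t ∈ Icc 0 D.T, |t - t₀| < δ →
    ∀ x : H, |f t x - f t₀ x| + ‖gradient (f t) x - gradient (f t₀) x‖ ≤ ε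

/-- `D_x u ∈ C([0,T]; C_u(H,H))`. -/
def GradInCTCuHH (u : ℝ × H → ℝ) : Prop :=
  (∀ t ∈ Icc 0 D.T, MemCuHH fun x : H => xGrad u (t, x)) ∧
  ∀ t₀ ∈ Icc 0 D.T, ∀ ε > 0, ∃ δ > 0, ∀ t ∈ Icc 0 D.T, |t - t₀| < δ →
    ∀ x : H, ‖xGrad u (t, x) - xGrad u (t₀, x)‖ ≤ ε

end FPData

end

section FokkerPlanck

variable {H : Type} [NormedAddCommGroup H] [InnerProductSpace ℝ H] [CompleteSpace H]
  [MeasurableSpace H]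

/-- A test function is dominated, uniformly in space, by a function of time which vanishes
at the final time. -/
theorem FPData.exists_bound_of_mem_EA (D : FPData H) {u : ℝ × H → ℝ} (hu : u ∈ D.EA) :
    ∃ ψ : ℝ → ℝ, (∀ t y, ‖u (t, y)‖ ≤ ψ t) ∧
      Tendsto ψ (𝓝[Icc 0 D.T] D.T) (𝓝 0) := by
  change u ∈ Submodule.span ℝ D.EAgen at hu
  induction hu using Submodule.span_induction with
  | mem u hu =>
    obtain ⟨φ, h, g, hφ, hφT, -, hu⟩ := hu
    refine ⟨fun t => |φ t|, fun t y => ?_, ?_⟩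
    · rcases hu with rfl | rfl <;> rw [Real.norm_eq_abs, abs_mul]
      · exact mul_le_of_le_one_right (abs_nonneg _) (Real.abs_cos_le_one _)
      · exact mul_le_of_le_one_right (abs_nonneg _) (Real.abs_sin_le_one _)
    · have := (hφ.continuousOn D.T ⟨D.hT.le, le_rfl⟩).abs
      simpa [ContinuousWithinAt, hφT] using this
  | zero => exact ⟨fun _ => 0, fun t y => by simp, tendsto_const_nhds⟩
  | add u v _ _ hu hv =>
    obtain ⟨ψ₁, h₁, l₁⟩ := hu
    obtain ⟨ψ₂, h₂, l₂⟩ := hv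
    exact ⟨fun t => ψ₁ t + ψ₂ t,
      fun t y => (norm_add_le _ _).trans (add_le_add (h₁ t y) (h₂ t y)),
      by simpa using l₁.add l₂⟩
  | smul a u _ hu =>
    obtain ⟨ψ, h, l⟩ := hu
    refine ⟨fun t => ‖a‖ * ψ t, fun t y => ?_, by simpa using l.const_mul ‖a‖⟩
    rw [Pi.smul_apply, norm_smul]
    exact mul_le_mul_of_nonneg_left (h t y) (norm_nonneg a)

/-- A measure `μ_t(dx) dt` on `[s,T] × H` is the composition-product of Lebesgue measure on
`[s,T]` with a finite kernel agreeing with `μ_t` on `[s,T]`. -/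
theorem FPData.IsFPSol.exists_compProd {D : FPData H} {s : ℝ} {ζ : Measure H}
    {μ : Measure (ℝ × H)} {μt : ℝ → Measure H} (hμ : D.IsFPSol s ζ μ μt) :
    ∃ κ : ProbabilityTheory.Kernel ℝ H, ProbabilityTheory.IsFiniteKernel κ ∧
      (∀ t ∈ Icc s D.T, κ t = μt t) ∧ μ = (volume.restrict (Icc s D.T)).compProd κ := by
  obtain ⟨hprob, ⟨hmeas, hker⟩, -, -⟩ := hμ
  let κ : ProbabilityTheory.Kernel ℝ H :=
    { toFun := fun t => if t ∈ Icc s D.T then μt t else 0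
      measurable' := Measurable.ite measurableSet_Icc
        (Measure.measurable_of_measurable_coe _ hmeas) measurable_const }
  have hκ : ∀ t ∈ Icc s D.T, κ t = μt t := fun t ht => if_pos ht
  have hfin : ProbabilityTheory.IsFiniteKernel κ := by
    refine ⟨1, ENNReal.one_lt_top, fun t => ?_⟩
    by_cases ht : t ∈ Icc s D.T
    · have := hprob t ht
      rw [hκ t ht]
      exact prob_le_one
    · have : κ t = 0 := if_neg ht
      simp [this]
  refine ⟨κ, hfin, hκ, Measure.ext fun E hE => ?_⟩
  rw [hker E hE, Measure.compProd_apply hE]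
  refine setLIntegral_congr_fun measurableSet_Icc fun t ht => ?_
  simp only [hκ t ht]
  rfl

/-- Letting `t → T` in the Fokker–Planck equation: `∫ L₀u dμ = -∫ u(s,·) dζ`. -/
theorem FPData.IsFPSol.integral_Lzero {D : FPData H} {s : ℝ} (hs : s ∈ Ico 0 D.T)
    {ζ : Measure H} {μ : Measure (ℝ × H)} {μt : ℝ → Measure H} (hμ : D.IsFPSol s ζ μ μt)
    {u : ℝ × H → ℝ} (hu : u ∈ D.EA) (hint : Integrable (D.Lzero u) μ) :
    ∫ p, D.Lzero u p ∂μ = -∫ y, u (s, y) ∂ζ := by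
  obtain ⟨κ, hfin, hκ, rfl⟩ := hμ.exists_compProd
  obtain ⟨hprob, -, -, heq⟩ := hμ
  obtain ⟨ψ, hψ, hψT⟩ := D.exists_bound_of_mem_EA hu
  set G : ℝ → ℝ := fun r => ∫ y, D.Lzero u (r, y) ∂(μt r) with hG
  have hGκ : ∀ r ∈ Icc s D.T, ∫ y, D.Lzero u (r, y) ∂(κ r) = G r := fun r hr => by
    rw [hG, hκ r hr]
  have hGint : IntegrableOn G (Icc s D.T) :=
    (integrableOn_congr_fun hGκ measurableSet_Icc).1 hint.integral_compProd
  have htot : ∫ p, D.Lzero u p ∂((volume.restrict (Icc s D.T)).compProd κ) =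
      ∫ r in Icc s D.T, G r :=
    (Measure.integral_compProd hint).trans (setIntegral_congr_fun measurableSet_Icc hGκ)
  have hIoo : Ioo s D.T ∈ 𝓝[<] D.T := Ioo_mem_nhdsLT hs.2
  have hle : 𝓝[<] D.T ≤ 𝓝[Icc s D.T] D.T :=
    nhdsWithin_le_of_mem (mem_of_superset hIoo Ioo_subset_Icc_self)
  have hlim₁ : Tendsto (fun t => ∫ y, u (t, y) ∂(μt t)) (𝓝[<] D.T) (𝓝 0) := by
    refine squeeze_zero_norm' (a := ψ) ?_
      (hψT.mono_left (hle.trans (nhdsWithin_mono _ (Icc_subset_Icc_left hs.1))))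
    filter_upwards [hIoo] with t ht
    have := hprob t (Ioo_subset_Icc_self ht)
    simpa using norm_integral_le_of_norm_le_const (μ := μt t)
      (Eventually.of_forall fun y => hψ t y)
  have hlim₂ : Tendsto (fun t => ∫ r in Icc s t, G r) (𝓝[<] D.T)
      (𝓝 (∫ r in Icc s D.T, G r)) :=
    (intervalIntegral.continuousOn_primitive_Icc hGint D.T ⟨hs.2.le, le_rfl⟩).mono_left hle
  have hfreq : ∃ᶠ t in 𝓝[<] D.T,
      ∫ y, u (t, y) ∂(μt t) = ∫ y, u (s, y) ∂ζ + ∫ r in Icc s t, G r := by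
    intro hev
    obtain ⟨l, hl, hlt⟩ := (mem_nhdsLT_iff_exists_Ioo_subset).1 (inter_mem hev hIoo)
    have hae := ae_restrict_of_ae_restrict_of_subset
      (fun t ht => Ioo_subset_Icc_self (hlt ht).2) (heq u hu)
    have hne : NeBot (ae (volume.restrict (Ioo l D.T))) := by
      rw [ae_neBot, Ne, Measure.restrict_eq_zero]
      simpa using hl
    obtain ⟨t, ht, ht'⟩ := (hae.and (ae_restrict_mem measurableSet_Ioo)).exists
    exact (hlt ht').1 ht
  have hmem := isClosed_singleton.mem_of_frequently_of_tendsto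
    (hfreq.mono fun t ht => (mem_singleton_iff (b := (0 : ℝ))).2 (sub_eq_zero.2 ht))
    (hlim₁.sub (hlim₂.const_add (∫ y, u (s, y) ∂ζ)))
  rw [mem_singleton_iff] at hmem
  rw [htot]
  linarith

end FokkerPlanck

/-- If every function of a class which is dense in `L¹(½μ₁ + ½μ₂)` has the same integral with
respect to `μ₁` and `μ₂`, then `μ₁ = μ₂`. -/
theorem DenseRangeL1.measure_eq {H : Type} [MeasurableSpace H]
    {μ₁ μ₂ : Measure (ℝ × H)} [IsFiniteMeasure μ₁] [IsFiniteMeasure μ₂]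
    {Sf : Set (ℝ × H → ℝ)}
    (hdense : DenseRangeL1 ((1 / 2 : ℝ≥0) • μ₁ + (1 / 2 : ℝ≥0) • μ₂) Sf)
    (heq : ∀ g ∈ Sf, Integrable g μ₁ → Integrable g μ₂ → ∫ p, g p ∂μ₁ = ∫ p, g p ∂μ₂) :
    μ₁ = μ₂ := by
  have hsplit : ∀ g : ℝ × H → ℝ,
      Integrable g ((1 / 2 : ℝ≥0) • μ₁ + (1 / 2 : ℝ≥0) • μ₂) →
      Integrable g μ₁ ∧ Integrable g μ₂ := fun g hg => by
    rw [integrable_add_measure] at hg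
    exact ⟨(integrable_smul_measure (c := ((1 / 2 : ℝ≥0) : ℝ≥0∞)) (by simp) (by simp)).1 hg.1,
      (integrable_smul_measure (c := ((1 / 2 : ℝ≥0) : ℝ≥0∞)) (by simp) (by simp)).1 hg.2⟩
  refine Measure.ext fun E hE => ?_
  set f : ℝ × H → ℝ := E.indicator 1 with hf
  have hfint : ∀ (ν : Measure (ℝ × H)) [IsFiniteMeasure ν], Integrable f ν := fun ν _ =>
    (integrable_const (1 : ℝ)).indicator hE
  have hfE : ∀ ν : Measure (ℝ × H), ∫ p, f p ∂ν = ν.real E := fun ν =>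
    integral_indicator_one hE
  suffices h : μ₁.real E = μ₂.real E from (measureReal_eq_measureReal_iff).1 h
  refine eq_of_abs_sub_le_all fun ε hε => ?_
  obtain ⟨g, hgS, hg, hfg⟩ := hdense f (hfint _) (ε / 2) (half_pos hε)
  obtain ⟨hg₁, hg₂⟩ := hsplit g hg
  have hd₁ : Integrable (fun p => |f p - g p|) μ₁ := ((hfint μ₁).sub hg₁).abs
  have hd₂ : Integrable (fun p => |f p - g p|) μ₂ := ((hfint μ₂).sub hg₂).abs
  rw [integral_add_measure (hd₁.smul_measure_nnreal) (hd₂.smul_measure_nnreal),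
    integral_smul_nnreal_measure, integral_smul_nnreal_measure] at hfg
  have h₁ : |∫ p, (f p - g p) ∂μ₁| ≤ ∫ p, |f p - g p| ∂μ₁ := abs_integral_le_integral_abs
  have h₂ : |∫ p, (f p - g p) ∂μ₂| ≤ ∫ p, |f p - g p| ∂μ₂ := abs_integral_le_integral_abs
  rw [integral_sub (hfint μ₁) hg₁, hfE] at h₁
  rw [integral_sub (hfint μ₂) hg₂, hfE, ← heq g hgS hg₁ hg₂] at h₂
  simp only [NNReal.smul_def, smul_eq_mul, NNReal.coe_div, NNReal.coe_one, NNReal.coe_ofNat]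
    at hfg
  rw [abs_le] at h₁ h₂ ⊢
  constructor <;> linarith

section Theorems

open MeasureTheory Set Filter Topology
open scoped InnerProductSpace ENNReal NNReal

variable {H : Type} [NormedAddCommGroup H] [InnerProductSpace ℝ H] [CompleteSpace H]
  [SecondCountableTopology H] [MeasurableSpace H] [BorelSpace H]

/-- Theorem 2.1: if `K ⊆ M_{s,ζ}` is convex and for every `μ ∈ K` the range
`L₀(D(L₀))` is dense in `L¹([s,T] × H, μ)`, then `K` contains at most one element. -/
theorem statement0 (D : FPData H) (s : ℝ) (hs : s ∈ Icc 0 D.T)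
    (ζ : Measure H) [IsProbabilityMeasure ζ]
    (K : Set (Measure (ℝ × H))) (hK : K ⊆ D.Mset s ζ)
    (hconv : ∀ μ₁ ∈ K, ∀ μ₂ ∈ K, ∀ a b : ℝ≥0, a + b = 1 → a • μ₁ + b • μ₂ ∈ K)
    (hdense : ∀ μ ∈ K, DenseRangeL1 μ (D.Lzero '' D.EA)) :
    K.Subsingleton := by
  intro μ₁ h₁ μ₂ h₂
  obtain ⟨ν₁, hν₁⟩ := hK h₁
  obtain ⟨ν₂, hν₂⟩ := hK h₂
  have hfinite : ∀ {μ : Measure (ℝ × H)} {ν : ℝ → Measure H}, D.IsFPSol s ζ μ ν →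
      IsFiniteMeasure μ := fun h => by
    obtain ⟨κ, hκ, -, rfl⟩ := h.exists_compProd
    infer_instance
  have := hfinite hν₁
  have := hfinite hν₂
  rcases hs.2.eq_or_lt with rfl | hsT
  · refine Measure.ext fun E hE => ?_
    rw [hν₁.2.1.2 E hE, hν₂.2.1.2 E hE]
    simp
  · refine (hdense _ (hconv μ₁ h₁ μ₂ h₂ (1 / 2) (1 / 2) (add_halves 1))).measure_eq ?_
    rintro _ ⟨u, hu, rfl⟩ hint₁ hint₂
    rw [hν₁.integral_Lzero ⟨hs.1, hsT⟩ hu hint₁, hν₂.integral_Lzero ⟨hs.1, hsT⟩ hu hint₂]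

end Theorems
end

section
/- Let (X, 𝒜) be a measurable space and S a set of real-valued measurable functions on X. Let K be a convex set of finite nonnegative measures on X such that: (a) every f ∈ S is μ-integrable for every μ ∈ K; (b) for every f ∈ S the integral ∫_X f dμ has a common value independent of μ ∈ K; (c) for every μ ∈ K, S is dense in L¹(X, μ). Then K contains at most one element. -/
open MeasureTheory Set Filter
open scoped NNReal

/-- If `f` approximates `g` in `L¹` of the average of two measures and has the same integral
against both, then the integrals of `g` are close. -/
lemma abs_integral_sub_integral_le_of_average {X : Type*} [MeasurableSpace X]
    {μ₁ μ₂ : Measure X} {f g : X → ℝ} (hf₁ : Integrable f μ₁) (hf₂ : Integrable f μ₂)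
    (hg₁ : Integrable g μ₁) (hg₂ : Integrable g μ₂)
    (hf : ∫ x, f x ∂μ₁ = ∫ x, f x ∂μ₂) :
    |∫ x, g x ∂μ₁ - ∫ x, g x ∂μ₂| ≤
      2 * ∫ x, |g x - f x| ∂((1 / 2 : ℝ≥0) • μ₁ + (1 / 2 : ℝ≥0) • μ₂) := by
  have i₁ : Integrable (fun x => |g x - f x|) μ₁ := (hg₁.sub hf₁).abs
  have i₂ : Integrable (fun x => |g x - f x|) μ₂ := (hg₂.sub hf₂).abs
  rw [integral_add_measure (i₁.smul_measure_nnreal) (i₂.smul_measure_nnreal),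
    integral_smul_nnreal_measure, integral_smul_nnreal_measure]
  have e₁ := abs_integral_le_integral_abs (μ := μ₁) (f := fun x => g x - f x)
  have e₂ := abs_integral_le_integral_abs (μ := μ₂) (f := fun x => g x - f x)
  rw [integral_sub hg₁ hf₁] at e₁
  rw [integral_sub hg₂ hf₂] at e₂
  simp only [NNReal.smul_def, smul_eq_mul, NNReal.coe_div, NNReal.coe_one, NNReal.coe_ofNat]
  rw [abs_le] at *
  constructor <;> linarith

/-- Let `(X, 𝒜)` be a measurable space and `S` a set of real-valued measurable
functions on `X`. Let `K` be a convex set of finite nonnegative measures on `X` such that: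
(a) every `f ∈ S` is `μ`-integrable for every `μ ∈ K`; (b) for every `f ∈ S` the integral
`∫ f dμ` has a common value independent of `μ ∈ K`; (c) for every `μ ∈ K`, `S` is dense in
`L¹(X, μ)`.  Then `K` contains at most one element. -/
theorem statement1 {X : Type*} [MeasurableSpace X] (S : Set (X → ℝ))
    (hSmeas : ∀ f ∈ S, Measurable f)
    (K : Set (Measure X)) (hfin : ∀ μ ∈ K, IsFiniteMeasure μ)
    (hconv : ∀ μ₁ ∈ K, ∀ μ₂ ∈ K, ∀ a b : ℝ≥0, a + b = 1 → a • μ₁ + b • μ₂ ∈ K)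
    (hint : ∀ μ ∈ K, ∀ f ∈ S, Integrable f μ)
    (hcommon : ∀ μ₁ ∈ K, ∀ μ₂ ∈ K, ∀ f ∈ S, ∫ x, f x ∂μ₁ = ∫ x, f x ∂μ₂)
    (hdense : ∀ μ ∈ K, ∀ g : X → ℝ, Integrable g μ → ∀ ε > 0,
      ∃ f ∈ S, ∫ x, |g x - f x| ∂μ < ε) :
    K.Subsingleton := by
  intro μ₁ h₁ μ₂ h₂
  have := hfin μ₁ h₁
  have := hfin μ₂ h₂
  ext A hA
  rw [← measureReal_eq_measureReal_iff]
  have hν := hconv μ₁ h₁ μ₂ h₂ (1 / 2) (1 / 2) (add_halves 1)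
  have := hfin _ hν
  have ind (μ : Measure X) [IsFiniteMeasure μ] : Integrable (A.indicator (1 : X → ℝ)) μ :=
    (integrable_const (1 : ℝ)).indicator hA
  refine eq_of_forall_dist_le fun ε hε => ?_
  obtain ⟨f, hfS, hf⟩ := hdense _ hν _ (ind _) (ε / 2) (half_pos hε)
  have key := abs_integral_sub_integral_le_of_average (hint μ₁ h₁ f hfS) (hint μ₂ h₂ f hfS)
    (ind μ₁) (ind μ₂) (hcommon μ₁ h₁ μ₂ h₂ f hfS)
  rw [integral_indicator_one hA, integral_indicator_one hA] at key
  rw [Real.dist_eq]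
  linarith
end

section
/- Let s ∈ [0,T], let ζ be a Borel probability measure on H, and let μ(dt,dx) = μ_t(dx)dt be a finite nonnegative measure on [s,T] × H, where (μ_t)_{t∈[s,T]} is a probability kernel from [s,T] to H, satisfying ∫_{[s,T]×H} (|⟨y, A*h(t)⟩| + |F(t,y)|) μ(dt,dy) < ∞ for every h ∈ C¹([0,T]; D(A*)). Then the following are equivalent: (i) for every u ∈ E_A([0,T]×H), ∫_H u(t,y) μ_t(dy) = ∫_H u(s,y) ζ(dy) + ∫_s^t ∫_H L₀u(r,y) μ_r(dy) dr for dt-a.e. t ∈ [s,T]; (ii) for every u ∈ E_A([0,T]×H), ∫_{[s,T]×H} L₀u(r,y) μ(dr,dy) = − ∫_H u(s,y) ζ(dy). -/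
open MeasureTheory Set Filter Topology
open scoped InnerProductSpace ENNReal NNReal

attribute [local instance] Classical.propDecidable

set_option linter.unusedSectionVars false

section KolmogorovCalculus

variable {H : Type} [NormedAddCommGroup H] [InnerProductSpace ℝ H] [CompleteSpace H]
  [SecondCountableTopology H] [MeasurableSpace H] [BorelSpace H]

namespace FPData

variable (D : FPData H)

/-- `u` has all the derivatives entering `L₀u` at `p`, with resulting value `ℓ`. -/
def HasLzeroAt (u : ℝ × H → ℝ) (p : ℝ × H) (ℓ : ℝ) : Prop :=
  ∃ (τ tr : ℝ) (a : H) (γ : H → H) (L : H →L[ℝ] H),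
    HasDerivAt (fun r => u (r, p.2)) τ p.1 ∧
    (∀ z, HasGradientAt (fun z => u (p.1, z)) (γ z) z) ∧
    HasFDerivAt γ L p.2 ∧
    HasSum (fun i : D.ι => ⟪L (D.sqrtC (D.basis i)), D.sqrtC (D.basis i)⟫_ℝ) tr ∧
    (γ p.2, a) ∈ D.A.adjoint.graph ∧
    ℓ = τ + (1 / 2) * tr + ⟪p.2, a⟫_ℝ + ⟪D.F p, γ p.2⟫_ℝ

variable {D} {u v : ℝ × H → ℝ} {p : ℝ × H} {ℓ m : ℝ}

theorem HasLzeroAt.Lzero_eq (h : D.HasLzeroAt u p ℓ) : D.Lzero u p = ℓ := by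
  obtain ⟨τ, tr, a, γ, L, hτ, hγ, hL, htr, ha, rfl⟩ := h
  have hg : (gradient fun z => u (p.1, z)) = γ := funext fun z => (hγ z).gradient
  have hx : xGrad u p = γ p.2 := (hγ p.2).gradient
  obtain ⟨y, hy⟩ := (LinearPMap.mem_graph_iff _).1 ha
  change (y : H) = γ p.2 ∧ D.A.adjoint y = a at hy
  have hmem : xGrad u p ∈ D.A.adjoint.domain := by
    rw [hx, ← hy.1]; exact y.2
  have hval : D.A.adjoint ⟨xGrad u p, hmem⟩ = a := by
    rw [← hy.2]; congr 1; exact Subtype.ext (hx.trans hy.1.symm)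
  simp only [Lzero, Vzero, traceCD2, dif_pos hmem]
  rw [hval, hτ.deriv, hg, hL.fderiv, htr.tsum_eq, hx]

theorem HasLzeroAt.add (hu : D.HasLzeroAt u p ℓ) (hv : D.HasLzeroAt v p m) :
    D.HasLzeroAt (u + v) p (ℓ + m) := by
  obtain ⟨τ, tr, a, γ, L, hτ, hγ, hL, htr, ha, rfl⟩ := hu
  obtain ⟨τ', tr', a', γ', L', hτ', hγ', hL', htr', ha', rfl⟩ := hv
  refine ⟨τ + τ', tr + tr', a + a', γ + γ', L + L', hτ.add hτ', fun z => ?_, hL.add hL', ?_,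
    add_mem ha ha', ?_⟩
  · rw [hasGradientAt_iff_hasFDerivAt, Pi.add_apply, map_add]
    exact (hγ z).hasFDerivAt.add (hγ' z).hasFDerivAt
  · simpa [inner_add_left] using htr.add htr'
  · simp only [Pi.add_apply, inner_add_right]; ring

/-- Leibniz rule for `L₀` and multiplication by a function of time. -/
theorem HasLzeroAt.mul_time {ψ : ℝ → ℝ} {ψ' : ℝ} (hu : D.HasLzeroAt u p ℓ)
    (hψ : HasDerivAt ψ ψ' p.1) :
    D.HasLzeroAt (fun q => ψ q.1 * u q) p (ψ' * u p + ψ p.1 * ℓ) := by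
  obtain ⟨τ, tr, a, γ, L, hτ, hγ, hL, htr, ha, rfl⟩ := hu
  refine ⟨ψ' * u p + ψ p.1 * τ, ψ p.1 * tr, ψ p.1 • a, ψ p.1 • γ, ψ p.1 • L, hψ.mul hτ,
    fun z => ?_, hL.const_smul _, ?_, D.A.adjoint.graph.smul_mem (ψ p.1) ha, ?_⟩
  · rw [hasGradientAt_iff_hasFDerivAt, Pi.smul_apply, map_smul]
    exact (hγ z).hasFDerivAt.const_mul (ψ p.1)
  · simpa [inner_smul_left] using htr.mul_left (ψ p.1)
  · simp only [Pi.smul_apply, inner_smul_right]; ring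

/-- `L₀` of a function of the form `φ(t) q(⟨x, h(t)⟩)`. -/
theorem hasLzeroAt_ridge {φ : ℝ → ℝ} {h : ℝ → H} {q q₁ q₂ : ℝ → ℝ} {φ' : ℝ} {h' a : H}
    (hφ : HasDerivAt φ φ' p.1) (hh : HasDerivAt h h' p.1) (hq : ∀ y, HasDerivAt q (q₁ y) y)
    (hq₁ : ∀ y, HasDerivAt q₁ (q₂ y) y) (ha : (h p.1, a) ∈ D.A.adjoint.graph) :
    D.HasLzeroAt (fun r => φ r.1 * q ⟪r.2, h r.1⟫_ℝ) p
      (φ' * q ⟪p.2, h p.1⟫_ℝ + φ p.1 * q₂ ⟪p.2, h p.1⟫_ℝ * ((1 / 2) * ‖D.sqrtC (h p.1)‖ ^ 2)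
        + φ p.1 * q₁ ⟪p.2, h p.1⟫_ℝ * (⟪p.2, a⟫_ℝ + ⟪D.F p, h p.1⟫_ℝ)
        + φ p.1 * q₁ ⟪p.2, h p.1⟫_ℝ * ⟪p.2, h'⟫_ℝ) := by
  have hin (z : H) : HasFDerivAt (fun z : H => ⟪z, h p.1⟫_ℝ) (innerSL ℝ (h p.1)) z := by
    have : (fun z : H => ⟪z, h p.1⟫_ℝ) = innerSL ℝ (h p.1) := by
      ext z; simp [real_inner_comm]
    rw [this]; exact (innerSL ℝ (h p.1)).hasFDerivAt
  have hin' : HasDerivAt (fun r => ⟪p.2, h r⟫_ℝ) ⟪p.2, h'⟫_ℝ p.1 :=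
    (innerSL ℝ p.2).hasFDerivAt.comp_hasDerivAt p.1 hh
  refine ⟨φ' * q ⟪p.2, h p.1⟫_ℝ + φ p.1 * (q₁ ⟪p.2, h p.1⟫_ℝ * ⟪p.2, h'⟫_ℝ),
    φ p.1 * q₂ ⟪p.2, h p.1⟫_ℝ * ‖D.sqrtC (h p.1)‖ ^ 2,
    (φ p.1 * q₁ ⟪p.2, h p.1⟫_ℝ) • a, fun z => (φ p.1 * q₁ ⟪z, h p.1⟫_ℝ) • h p.1,
    (φ p.1 • (q₂ ⟪p.2, h p.1⟫_ℝ • innerSL ℝ (h p.1))).smulRight (h p.1), ?_, fun z => ?_, ?_, ?_,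
    D.A.adjoint.graph.smul_mem _ ha, ?_⟩
  · exact hφ.mul ((hq _).comp p.1 hin')
  · rw [hasGradientAt_iff_hasFDerivAt]
    have := ((hq _).comp_hasFDerivAt z (hin z)).const_mul (φ p.1)
    convert! this using 1
    ext w
    simp [mul_assoc]
  · exact (((hq₁ _).comp_hasFDerivAt p.2 (hin p.2)).const_mul (φ p.1)).smul_const (h p.1)
  · have hsa (x y : H) : ⟪D.sqrtC x, y⟫_ℝ = ⟪x, D.sqrtC y⟫_ℝ := by
      have := D.sqrtC_pos.isSymmetric x y
      simpa using this
    have h1 := D.basis.hasSum_inner_mul_inner (D.sqrtC (h p.1)) (D.sqrtC (h p.1))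
    rw [real_inner_self_eq_norm_sq] at h1
    have h2 := h1.mul_left (φ p.1 * q₂ ⟪p.2, h p.1⟫_ℝ)
    refine HasSum.congr_fun h2 fun i => ?_
    simp [inner_smul_left, hsa, real_inner_comm]
    ring
  · simp only [inner_smul_right]; ring

end FPData

end KolmogorovCalculus

section TestFunctions

variable {H : Type} [NormedAddCommGroup H] [InnerProductSpace ℝ H] [CompleteSpace H]
  [SecondCountableTopology H] [MeasurableSpace H] [BorelSpace H]

theorem ContDiffOn.hasDerivAt_derivWithin_Icc {E : Type*} [NormedAddCommGroup E]
    [NormedSpace ℝ E] {f : ℝ → E} {a b t : ℝ} (hf : ContDiffOn ℝ 1 f (Icc a b))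
    (ht : t ∈ Ioo a b) : HasDerivAt f (derivWithin f (Icc a b) t) t :=
  ((hf.differentiableOn one_ne_zero t (Ioo_subset_Icc_self ht)).hasDerivWithinAt).hasDerivAt
    (Icc_mem_nhds ht.1 ht.2)

namespace FPData

variable {D : FPData H} {u v : ℝ × H → ℝ} {p : ℝ × H}

theorem continuousOn_derivWithin {E : Type*} [NormedAddCommGroup E] [NormedSpace ℝ E]
    {f : ℝ → E} (hf : ContDiffOn ℝ 1 f (Icc 0 D.T)) :
    ContinuousOn (derivWithin f (Icc 0 D.T)) (Icc 0 D.T) :=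
  hf.continuousOn_derivWithin (uniqueDiffOn_Icc D.hT) le_rfl

theorem EA_cos {φ : ℝ → ℝ} {h g : ℝ → H} (hφ : ContDiffOn ℝ 1 φ (Icc 0 D.T)) (hT : φ D.T = 0)
    (hh : D.CinDAstar h g) : (fun p : ℝ × H => φ p.1 * Real.cos ⟪p.2, h p.1⟫_ℝ) ∈ D.EA :=
  Submodule.subset_span ⟨φ, h, g, hφ, hT, hh, Or.inl rfl⟩

theorem EA_sin {φ : ℝ → ℝ} {h g : ℝ → H} (hφ : ContDiffOn ℝ 1 φ (Icc 0 D.T)) (hT : φ D.T = 0)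
    (hh : D.CinDAstar h g) : (fun p : ℝ × H => φ p.1 * Real.sin ⟪p.2, h p.1⟫_ℝ) ∈ D.EA :=
  Submodule.subset_span ⟨φ, h, g, hφ, hT, hh, Or.inr rfl⟩

theorem EA_add (hu : u ∈ D.EA) (hv : v ∈ D.EA) : u + v ∈ D.EA :=
  Submodule.add_mem (Submodule.span ℝ D.EAgen) hu hv

theorem EA_smul (c : ℝ) (hu : u ∈ D.EA) : c • u ∈ D.EA :=
  Submodule.smul_mem (Submodule.span ℝ D.EAgen) c hu

/-- The profiles `(q, q', q'')` of the generators of `E_A`. -/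
def IsTrigProfile (q q₁ q₂ : ℝ → ℝ) : Prop :=
  (q = Real.cos ∧ q₁ = (fun y => -Real.sin y) ∧ q₂ = fun y => -Real.cos y) ∨
    (q = Real.sin ∧ q₁ = Real.cos ∧ q₂ = fun y => -Real.sin y)

/-- Bounded `C²` profiles, with their two derivatives. -/
structure IsBoundedProfile (q q₁ q₂ : ℝ → ℝ) : Prop where
  deriv₀ : ∀ y, HasDerivAt q (q₁ y) y
  deriv₁ : ∀ y, HasDerivAt q₁ (q₂ y) y
  cont₂ : Continuous q₂
  bound : ∃ M, ∀ y, |q y| ≤ M ∧ |q₁ y| ≤ M ∧ |q₂ y| ≤ M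

theorem IsTrigProfile.isBoundedProfile {q q₁ q₂ : ℝ → ℝ} (h : IsTrigProfile q q₁ q₂) :
    IsBoundedProfile q q₁ q₂ := by
  rcases h with ⟨rfl, rfl, rfl⟩ | ⟨rfl, rfl, rfl⟩
  · exact ⟨Real.hasDerivAt_cos, fun y => (Real.hasDerivAt_sin y).neg, by fun_prop, 1,
      fun y => by simp [Real.abs_cos_le_one, Real.abs_sin_le_one]⟩
  · exact ⟨Real.hasDerivAt_sin, Real.hasDerivAt_cos, by fun_prop, 1,
      fun y => by simp [Real.abs_cos_le_one, Real.abs_sin_le_one]⟩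

theorem EA_induction {P : (ℝ × H → ℝ) → Prop}
    (gen : ∀ (φ : ℝ → ℝ) (h g : ℝ → H) (q q₁ q₂ : ℝ → ℝ), ContDiffOn ℝ 1 φ (Icc 0 D.T) →
      φ D.T = 0 → D.CinDAstar h g → IsTrigProfile q q₁ q₂ →
      P fun p => φ p.1 * q ⟪p.2, h p.1⟫_ℝ)
    (zero : P 0) (add : ∀ u ∈ D.EA, ∀ v ∈ D.EA, P u → P v → P (u + v))
    (smul : ∀ (c : ℝ), ∀ u ∈ D.EA, P u → P (c • u)) (hu : u ∈ D.EA) : P u := by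
  refine Submodule.span_induction (p := fun u _ => P u) ?_ zero
    (fun u v hu hv => add u hu v hv) (fun c u hu => smul c u hu) hu
  rintro u ⟨φ, h, g, hφ, hT, hh, rfl | rfl⟩
  · exact gen φ h g _ _ _ hφ hT hh (Or.inl ⟨rfl, rfl, rfl⟩)
  · exact gen φ h g _ _ _ hφ hT hh (Or.inr ⟨rfl, rfl, rfl⟩)

/-- The part of `L₀(φ(t) q(⟨x, h(t)⟩))` not involving `h'`. -/
noncomputable def ridgeReg (D : FPData H) (φ : ℝ → ℝ) (h g : ℝ → H) (q q₁ q₂ : ℝ → ℝ)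
    (p : ℝ × H) : ℝ :=
  derivWithin φ (Icc 0 D.T) p.1 * q ⟪p.2, h p.1⟫_ℝ
    + φ p.1 * q₂ ⟪p.2, h p.1⟫_ℝ * ((1 / 2) * ‖D.sqrtC (h p.1)‖ ^ 2)
    + φ p.1 * q₁ ⟪p.2, h p.1⟫_ℝ * (⟪p.2, g p.1⟫_ℝ + ⟪D.F p, h p.1⟫_ℝ)

/-- The part of `L₀(φ(t) q(⟨x, h(t)⟩))` involving `h'`. -/
noncomputable def ridgeDrift (D : FPData H) (φ : ℝ → ℝ) (h : ℝ → H) (q₁ : ℝ → ℝ)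
    (p : ℝ × H) : ℝ :=
  φ p.1 * q₁ ⟪p.2, h p.1⟫_ℝ * ⟪p.2, derivWithin h (Icc 0 D.T) p.1⟫_ℝ

theorem hasLzeroAt_ridge' {φ : ℝ → ℝ} {h g : ℝ → H} {q q₁ q₂ : ℝ → ℝ}
    (hφ : ContDiffOn ℝ 1 φ (Icc 0 D.T)) (hh : D.CinDAstar h g) (hq : IsBoundedProfile q q₁ q₂)
    (hp : p.1 ∈ Ioo 0 D.T) :
    D.HasLzeroAt (fun p => φ p.1 * q ⟪p.2, h p.1⟫_ℝ) p
      (D.ridgeReg φ h g q q₁ q₂ p + D.ridgeDrift φ h q₁ p) :=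
  hasLzeroAt_ridge (hφ.hasDerivAt_derivWithin_Icc hp) (hh.1.hasDerivAt_derivWithin_Icc hp)
    hq.deriv₀ hq.deriv₁ (hh.2.2 _ (Ioo_subset_Icc_self hp))

theorem hasLzeroAt_zero : D.HasLzeroAt 0 p 0 :=
  ⟨0, 0, 0, 0, 0, hasDerivAt_const _ _, fun z => hasGradientAt_const _ _,
    hasFDerivAt_const _ _, by simp, zero_mem _, by simp⟩

theorem HasLzeroAt.smul {ℓ : ℝ} (c : ℝ) (hu : D.HasLzeroAt u p ℓ) :
    D.HasLzeroAt (c • u) p (c * ℓ) := by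
  have := hu.mul_time (hasDerivAt_const p.1 c)
  simp only [zero_mul, zero_add] at this
  exact this

theorem hasLzeroAt (hu : u ∈ D.EA) (hp : p.1 ∈ Ioo 0 D.T) :
    D.HasLzeroAt u p (D.Lzero u p) := by
  suffices h : ∃ ℓ, D.HasLzeroAt u p ℓ by
    obtain ⟨ℓ, h⟩ := h
    rwa [h.Lzero_eq]
  refine EA_induction (P := fun u => ∃ ℓ, D.HasLzeroAt u p ℓ) ?_ ⟨0, hasLzeroAt_zero⟩ ?_ ?_ hu
  · intro φ h g q q₁ q₂ hφ _ hh hq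
    exact ⟨_, hasLzeroAt_ridge' hφ hh hq.isBoundedProfile hp⟩
  · rintro u _ v _ ⟨ℓ, h⟩ ⟨m, h'⟩
    exact ⟨_, h.add h'⟩
  · rintro c u _ ⟨ℓ, h⟩
    exact ⟨_, h.smul c⟩

theorem Lzero_add (hu : u ∈ D.EA) (hv : v ∈ D.EA) (hp : p.1 ∈ Ioo 0 D.T) :
    D.Lzero (u + v) p = D.Lzero u p + D.Lzero v p :=
  ((hasLzeroAt hu hp).add (hasLzeroAt hv hp)).Lzero_eq

theorem Lzero_smul (c : ℝ) (hu : u ∈ D.EA) (hp : p.1 ∈ Ioo 0 D.T) :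
    D.Lzero (c • u) p = c * D.Lzero u p :=
  ((hasLzeroAt hu hp).smul c).Lzero_eq

theorem EA_mul_time {ψ : ℝ → ℝ} (hψ : ContDiffOn ℝ 1 ψ (Icc 0 D.T)) (hu : u ∈ D.EA) :
    (fun p => ψ p.1 * u p) ∈ D.EA := by
  refine EA_induction (P := fun u => (fun p => ψ p.1 * u p) ∈ D.EA) ?_ ?_ ?_ ?_ hu
  · rintro φ h g q q₁ q₂ hφ hT hh (⟨rfl, -, -⟩ | ⟨rfl, -, -⟩)
    · have := EA_cos (hψ.mul hφ) (by simp [hT]) hh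
      simpa only [mul_assoc] using this
    · have := EA_sin (hψ.mul hφ) (by simp [hT]) hh
      simpa only [mul_assoc] using this
  · simp only [Pi.zero_apply, mul_zero]
    exact Submodule.zero_mem (Submodule.span ℝ D.EAgen)
  · intro u _ v _ h h'
    convert! EA_add h h' using 1
    ext p; simp [mul_add]
  · intro c u _ h
    convert! EA_smul c h using 1
    ext p; simp only [Pi.smul_apply, smul_eq_mul]; ring

theorem cinDAstar_const {k g : H} (hk : (k, g) ∈ D.A.adjoint.graph) :
    D.CinDAstar (fun _ => k) (fun _ => g) :=
  ⟨contDiffOn_const, contDiffOn_const, fun _ _ => hk⟩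

theorem EA_time : (fun p : ℝ × H => D.T - p.1) ∈ D.EA := by
  have := EA_cos (D := D) (φ := fun t => D.T - t) (h := fun _ => 0) (g := fun _ => 0)
    (by fun_prop) (by simp) (cinDAstar_const (zero_mem _))
  simpa using this

theorem Lzero_time (hp : p.1 ∈ Ioo 0 D.T) : D.Lzero (fun p => D.T - p.1) p = -1 := by
  have h := hasLzeroAt_ridge' (D := D) (φ := fun t => D.T - t) (h := fun _ => 0) (g := fun _ => 0)
    (by fun_prop) (cinDAstar_const (zero_mem _))
    (IsTrigProfile.isBoundedProfile (Or.inl ⟨rfl, rfl, rfl⟩)) hp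
  simp only [inner_zero_right, Real.cos_zero, mul_one] at h
  have hd : derivWithin (fun t => D.T - t) (Icc 0 D.T) p.1 = -1 := by
    have h1 : HasDerivAt (fun t => D.T - t) (-1) p.1 := by
      simpa using (hasDerivAt_id p.1).const_sub D.T
    exact h1.hasDerivWithinAt.derivWithin (uniqueDiffOn_Icc D.hT _ (Ioo_subset_Icc_self hp))
  rw [h.Lzero_eq]
  simp [ridgeReg, ridgeDrift, hd]

theorem EA_continuousOn (hu : u ∈ D.EA) : ContinuousOn u (Icc 0 D.T ×ˢ univ) := by
  refine EA_induction (P := fun u => ContinuousOn u (Icc 0 D.T ×ˢ univ)) ?_ continuousOn_const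
    (fun u _ v _ => ContinuousOn.add) (fun c u _ h => h.const_smul c) hu
  intro φ h g q q₁ q₂ hφ _ hh hq
  have hm : MapsTo (Prod.fst : ℝ × H → ℝ) (Icc 0 D.T ×ˢ univ) (Icc 0 D.T) := fun p hp => hp.1
  have hq' : Continuous q :=
    continuous_iff_continuousAt.2 fun y => (hq.isBoundedProfile.deriv₀ y).continuousAt
  exact (hφ.continuousOn.comp continuousOn_fst hm).mul (hq'.comp_continuousOn
    (continuousOn_snd.inner (𝕜 := ℝ) (hh.1.continuousOn.comp continuousOn_fst hm)))

theorem EA_bound (hu : u ∈ D.EA) : ∃ ω : ℝ → ℝ, ContinuousOn ω (Icc 0 D.T) ∧ ω D.T = 0 ∧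
    ∀ p, |u p| ≤ ω p.1 := by
  refine EA_induction (P := fun u => ∃ ω : ℝ → ℝ, ContinuousOn ω (Icc 0 D.T) ∧ ω D.T = 0 ∧
    ∀ p, |u p| ≤ ω p.1) ?_ ⟨0, continuousOn_const, rfl, by simp⟩ ?_ ?_ hu
  · intro φ h g q q₁ q₂ hφ hT _ hq
    refine ⟨fun t => |φ t|, hφ.continuousOn.abs, by simp [hT], fun p => ?_⟩
    rw [abs_mul]
    have : |q ⟪p.2, h p.1⟫_ℝ| ≤ 1 := by
      rcases hq with ⟨rfl, -, -⟩ | ⟨rfl, -, -⟩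
      exacts [Real.abs_cos_le_one _, Real.abs_sin_le_one _]
    exact mul_le_of_le_one_right (abs_nonneg _) this
  · rintro u _ v _ ⟨ω, h1, h2, h3⟩ ⟨ω', h1', h2', h3'⟩
    exact ⟨ω + ω', h1.add h1', by simp [h2, h2'], fun p => (abs_add_le _ _).trans
      (add_le_add (h3 p) (h3' p))⟩
  · rintro c u _ ⟨ω, h1, h2, h3⟩
    refine ⟨fun t => |c| * ω t, continuousOn_const.mul h1, by simp [h2], fun p => ?_⟩
    simp only [Pi.smul_apply, smul_eq_mul, abs_mul]
    exact mul_le_mul_of_nonneg_left (h3 p) (abs_nonneg c)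

end FPData

end TestFunctions

section Integrability

variable {H : Type} [NormedAddCommGroup H] [InnerProductSpace ℝ H] [CompleteSpace H]
  [SecondCountableTopology H] [MeasurableSpace H] [BorelSpace H]

namespace FPData

variable {D : FPData H} {u : ℝ × H → ℝ} {μ : Measure (ℝ × H)}

theorem aestronglyMeasurable_of_continuousOn {E : Type*} [NormedAddCommGroup E]
    [SecondCountableTopology E] {f : ℝ × H → E}
    (hf : ContinuousOn f (Icc 0 D.T ×ˢ univ)) (hI : ∀ᵐ p ∂μ, p.1 ∈ Ioo 0 D.T) :
    AEStronglyMeasurable f μ := by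
  have h := hf.aestronglyMeasurable (μ := μ) (measurableSet_Icc.prod .univ)
  rwa [Measure.restrict_eq_self_of_ae_mem] at h
  filter_upwards [hI] with p hp using ⟨Ioo_subset_Icc_self hp, mem_univ _⟩

theorem continuousOn_time {E : Type*} [NormedAddCommGroup E] {f : ℝ → E}
    (hf : ContinuousOn f (Icc 0 D.T)) :
    ContinuousOn (fun p : ℝ × H => f p.1) (Icc 0 D.T ×ˢ univ) :=
  hf.comp continuousOn_fst fun _ hp => hp.1

theorem continuousOn_inner_time {f : ℝ → H} (hf : ContinuousOn f (Icc 0 D.T)) :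
    ContinuousOn (fun p : ℝ × H => ⟪p.2, f p.1⟫_ℝ) (Icc 0 D.T ×ˢ univ) :=
  continuousOn_snd.inner (𝕜 := ℝ) (continuousOn_time hf)

theorem exists_bound_time {E : Type*} [NormedAddCommGroup E] {f : ℝ → E}
    (hf : ContinuousOn f (Icc 0 D.T)) : ∃ M, ∀ t ∈ Icc 0 D.T, ‖f t‖ ≤ M :=
  isCompact_Icc.exists_bound_of_continuousOn hf

theorem IsBoundedProfile.continuous {q q₁ q₂ : ℝ → ℝ} (hq : IsBoundedProfile q q₁ q₂) :
    Continuous q ∧ Continuous q₁ ∧ Continuous q₂ :=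
  ⟨continuous_iff_continuousAt.2 fun y => (hq.deriv₀ y).continuousAt,
    continuous_iff_continuousAt.2 fun y => (hq.deriv₁ y).continuousAt, hq.cont₂⟩

theorem DriftIntegrable.integrable_F (hd : D.DriftIntegrable μ) : Integrable D.F μ := by
  refine ⟨D.F_meas.aestronglyMeasurable, lt_of_le_of_lt (lintegral_mono fun p => ?_)
    (hd _ _ (cinDAstar_const (zero_mem D.A.adjoint.graph)))⟩
  refine le_trans ?_ le_add_self
  unfold FnormE
  split_ifs
  · exact le_rfl
  · exact le_top

theorem DriftIntegrable.integrable_inner (hd : D.DriftIntegrable μ)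
    (hI : ∀ᵐ p ∂μ, p.1 ∈ Ioo 0 D.T) {h g : ℝ → H} (hh : D.CinDAstar h g) :
    Integrable (fun p : ℝ × H => ⟪p.2, g p.1⟫_ℝ) μ :=
  ⟨aestronglyMeasurable_of_continuousOn (continuousOn_inner_time hh.2.1.continuousOn) hI,
    lt_of_le_of_lt (lintegral_mono fun _ => le_self_add) (hd h g hh)⟩

theorem integrable_of_continuousOn_of_bound [IsFiniteMeasure μ] {f : ℝ × H → ℝ} {M : ℝ}
    (hI : ∀ᵐ p ∂μ, p.1 ∈ Ioo 0 D.T)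
    (hf : ContinuousOn f (Icc 0 D.T ×ˢ univ)) (hb : ∀ p : ℝ × H, p.1 ∈ Icc 0 D.T → |f p| ≤ M) :
    Integrable f μ :=
  Integrable.of_bound (aestronglyMeasurable_of_continuousOn hf hI) M
    (by filter_upwards [hI] with p hp using hb p (Ioo_subset_Icc_self hp))

section Ridge

variable {φ : ℝ → ℝ} {h g : ℝ → H} {q q₁ q₂ : ℝ → ℝ}

theorem integrable_inner_F [IsFiniteMeasure μ] (hI : ∀ᵐ p ∂μ, p.1 ∈ Ioo 0 D.T)
    (hd : D.DriftIntegrable μ) (hh : ContinuousOn h (Icc 0 D.T)) :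
    Integrable (fun p : ℝ × H => ⟪D.F p, h p.1⟫_ℝ) μ := by
  obtain ⟨M, hM⟩ := exists_bound_time hh
  refine (hd.integrable_F.norm.mul_const M).mono'
    (D.F_meas.aestronglyMeasurable.inner
      (aestronglyMeasurable_of_continuousOn (continuousOn_time hh) hI)) ?_
  filter_upwards [hI] with p hp
  exact (norm_inner_le_norm _ _).trans
    (mul_le_mul_of_nonneg_left (hM _ (Ioo_subset_Icc_self hp)) (norm_nonneg _))

theorem integrable_ridgeReg [IsFiniteMeasure μ] (hI : ∀ᵐ p ∂μ, p.1 ∈ Ioo 0 D.T)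
    (hd : D.DriftIntegrable μ) (hφ : ContDiffOn ℝ 1 φ (Icc 0 D.T)) (hh : D.CinDAstar h g)
    (hq : IsBoundedProfile q q₁ q₂) : Integrable (D.ridgeReg φ h g q q₁ q₂) μ := by
  obtain ⟨M, hM⟩ := hq.bound
  obtain ⟨c0, c1, c2⟩ := hq.continuous
  have hin := continuousOn_inner_time (D := D) hh.1.continuousOn
  have cφ := continuousOn_time (H := H) hφ.continuousOn
  have cφ' := continuousOn_time (H := H) (continuousOn_derivWithin hφ)
  have cC : ContinuousOn (fun t => (1 / 2) * ‖D.sqrtC (h t)‖ ^ 2) (Icc 0 D.T) :=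
    continuousOn_const.mul ((D.sqrtC.continuous.comp_continuousOn hh.1.continuousOn).norm.pow 2)
  obtain ⟨Mφ, hMφ⟩ := exists_bound_time hφ.continuousOn
  obtain ⟨Mφ', hMφ'⟩ := exists_bound_time (continuousOn_derivWithin hφ)
  obtain ⟨MC, hMC⟩ := exists_bound_time cC
  refine Integrable.add (Integrable.add ?_ ?_) ?_
  · refine integrable_of_continuousOn_of_bound (M := Mφ' * M) hI
      (cφ'.mul (c0.comp_continuousOn hin)) fun p hp => ?_
    rw [abs_mul]
    exact mul_le_mul (hMφ' _ hp) (hM _).1 (abs_nonneg _) ((norm_nonneg _).trans (hMφ' _ hp))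
  · refine integrable_of_continuousOn_of_bound (M := Mφ * M * MC) hI
      ((cφ.mul (c2.comp_continuousOn hin)).mul (continuousOn_time cC)) fun p hp => ?_
    rw [abs_mul, abs_mul]
    have h1 := (norm_nonneg _).trans (hMφ _ hp)
    exact mul_le_mul (mul_le_mul (hMφ _ hp) (hM _).2.2 (abs_nonneg _) h1) (hMC _ hp)
      (abs_nonneg _) (mul_nonneg h1 ((abs_nonneg _).trans (hM 0).1))
  · refine ((hd.integrable_inner hI hh).add (integrable_inner_F hI hd hh.1.continuousOn)).bdd_mul
      (c := Mφ * M) (aestronglyMeasurable_of_continuousOn (cφ.mul (c1.comp_continuousOn hin)) hI) ?_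
    filter_upwards [hI] with p hp
    rw [norm_mul]
    have hp := Ioo_subset_Icc_self hp
    exact mul_le_mul (hMφ _ hp) (hM _).2.1 (abs_nonneg _) ((norm_nonneg _).trans (hMφ _ hp))

theorem aestronglyMeasurable_ridgeDrift (hI : ∀ᵐ p ∂μ, p.1 ∈ Ioo 0 D.T)
    (hφ : ContDiffOn ℝ 1 φ (Icc 0 D.T)) (hh : D.CinDAstar h g) (hq₁ : Continuous q₁) :
    AEStronglyMeasurable (D.ridgeDrift φ h q₁) μ :=
  aestronglyMeasurable_of_continuousOn (((continuousOn_time hφ.continuousOn).mul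
    (hq₁.comp_continuousOn (continuousOn_inner_time hh.1.continuousOn))).mul
      (continuousOn_inner_time (continuousOn_derivWithin hh.1))) hI

theorem integrable_ridgeDrift (hI : ∀ᵐ p ∂μ, p.1 ∈ Ioo 0 D.T)
    (hφ : ContDiffOn ℝ 1 φ (Icc 0 D.T)) (hh : D.CinDAstar h g)
    (hq : IsBoundedProfile q q₁ q₂)
    (hint : Integrable (fun p : ℝ × H => ⟪p.2, derivWithin h (Icc 0 D.T) p.1⟫_ℝ) μ) :
    Integrable (D.ridgeDrift φ h q₁) μ := by
  obtain ⟨M, hM⟩ := hq.bound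
  obtain ⟨Mφ, hMφ⟩ := exists_bound_time hφ.continuousOn
  refine hint.bdd_mul (c := Mφ * M) (aestronglyMeasurable_of_continuousOn
    ((continuousOn_time hφ.continuousOn).mul
    (hq.continuous.2.1.comp_continuousOn (continuousOn_inner_time hh.1.continuousOn))) hI) ?_
  filter_upwards [hI] with p hp
  rw [norm_mul]
  have hp := Ioo_subset_Icc_self hp
  exact mul_le_mul (hMφ _ hp) (hM _).2.1 (abs_nonneg _) ((norm_nonneg _).trans (hMφ _ hp))

end Ridge

theorem aestronglyMeasurable_Lzero [IsFiniteMeasure μ] (hI : ∀ᵐ p ∂μ, p.1 ∈ Ioo 0 D.T)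
    (hd : D.DriftIntegrable μ) (hu : u ∈ D.EA) : AEStronglyMeasurable (D.Lzero u) μ := by
  refine EA_induction (P := fun u => AEStronglyMeasurable (D.Lzero u) μ) ?_ ?_ ?_ ?_ hu
  · intro φ h g q q₁ q₂ hφ _ hh hq
    have hq := hq.isBoundedProfile
    refine ((integrable_ridgeReg hI hd hφ hh hq).aestronglyMeasurable.add
      (aestronglyMeasurable_ridgeDrift hI hφ hh hq.continuous.2.1)).congr ?_
    filter_upwards [hI] with p hp using (hasLzeroAt_ridge' hφ hh hq hp).Lzero_eq.symm
  · exact (aestronglyMeasurable_const (b := (0 : ℝ))).congr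
      (ae_of_all _ fun p => hasLzeroAt_zero.Lzero_eq.symm)
  · intro u hu v hv h h'
    refine (h.add h').congr ?_
    filter_upwards [hI] with p hp using (Lzero_add hu hv hp).symm
  · intro c u hu h
    refine (h.const_mul c).congr ?_
    filter_upwards [hI] with p hp using (Lzero_smul c hu hp).symm

theorem integrable_Lzero [IsFiniteMeasure μ] (hI : ∀ᵐ p ∂μ, p.1 ∈ Ioo 0 D.T)
    (hd : D.DriftIntegrable μ)
    (hint : ∀ h g : ℝ → H, D.CinDAstar h g →
      Integrable (fun p : ℝ × H => ⟪p.2, derivWithin h (Icc 0 D.T) p.1⟫_ℝ) μ)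
    (hu : u ∈ D.EA) : Integrable (D.Lzero u) μ := by
  refine EA_induction (P := fun u => Integrable (D.Lzero u) μ) ?_ ?_ ?_ ?_ hu
  · intro φ h g q q₁ q₂ hφ _ hh hq
    have hq := hq.isBoundedProfile
    refine ((integrable_ridgeReg hI hd hφ hh hq).add
      (integrable_ridgeDrift hI hφ hh hq (hint h g hh))).congr ?_
    filter_upwards [hI] with p hp using (hasLzeroAt_ridge' hφ hh hq hp).Lzero_eq.symm
  · exact (integrable_zero _ ℝ μ).congr
      (ae_of_all _ fun p => hasLzeroAt_zero.Lzero_eq.symm)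
  · intro u hu v hv h h'
    refine (h.add h').congr ?_
    filter_upwards [hI] with p hp using (Lzero_add hu hv hp).symm
  · intro c u hu h
    refine (h.const_mul c).congr ?_
    filter_upwards [hI] with p hp using (Lzero_smul c hu hp).symm

end FPData

end Integrability

section PrimitiveTest

theorem integral_primitive_mul {θ G : ℝ → ℝ} {a b : ℝ} (hab : a ≤ b) (hθ : Continuous θ)
    (hG : IntegrableOn G (Icc a b)) :
    ∫ t in Icc a b, (∫ v in a..t, θ v) * G t =
      (∫ t in Icc a b, θ t) * (∫ t in Icc a b, G t) -
        ∫ t in Icc a b, θ t * ∫ v in Icc a t, G v := by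
  have hGi : IntervalIntegrable G volume a b :=
    (intervalIntegrable_iff_integrableOn_Icc_of_le hab).2 hG
  have hac := AbsolutelyContinuousOnInterval.integral_mul_deriv_eq_deriv_mul
    ((hθ.intervalIntegrable a b).absolutelyContinuousOnInterval_intervalIntegral
      (left_mem_uIcc (a := a) (b := b)))
    (hGi.absolutelyContinuousOnInterval_intervalIntegral (left_mem_uIcc (a := a) (b := b)))
  have h1 : ∫ x in a..b, (∫ v in a..x, θ v) * deriv (fun x => ∫ v in a..x, G v) x =
      ∫ x in a..b, (∫ v in a..x, θ v) * G x := by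
    refine intervalIntegral.integral_congr_ae ?_
    filter_upwards [hGi.ae_hasDerivAt_integral] with x hx hx'
    rw [(hx (uIoc_subset_uIcc hx') a left_mem_uIcc).deriv]
  have h2 : ∫ x in a..b, deriv (fun x => ∫ v in a..x, θ v) x * ∫ v in a..x, G v =
      ∫ x in a..b, θ x * ∫ v in Icc a x, G v := by
    refine intervalIntegral.integral_congr fun x hx => ?_
    rw [uIcc_of_le hab] at hx
    rw [hθ.deriv_integral, intervalIntegral.integral_of_le hx.1, integral_Icc_eq_integral_Ioc]
  rw [h1, h2] at hac
  simpa only [intervalIntegral.integral_same, mul_zero, sub_zero,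
    intervalIntegral.integral_of_le hab, ← integral_Icc_eq_integral_Ioc] using hac

theorem ae_restrict_Icc_eq_zero_of_integral_smooth_mul {f : ℝ → ℝ} {a b : ℝ}
    (hf : IntegrableOn f (Icc a b))
    (h : ∀ θ : ℝ → ℝ, ContDiff ℝ 1 θ → ∫ t in Icc a b, θ t * f t = 0) :
    ∀ᵐ t ∂volume.restrict (Icc a b), f t = 0 := by
  rw [ae_restrict_iff' measurableSet_Icc]
  have h0 := ae_eq_zero_of_integral_contDiff_smul_eq_zero (μ := volume)
    ((integrable_indicator_iff measurableSet_Icc).2 hf).locallyIntegrable fun θ hθ _ => by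
      rw [← h θ (hθ.of_le (by exact_mod_cast le_top)), ← integral_indicator measurableSet_Icc]
      refine integral_congr_ae (ae_of_all _ fun t => ?_)
      by_cases ht : t ∈ Icc a b <;> simp [ht]
  filter_upwards [h0] with t ht hmem
  rwa [indicator_of_mem hmem] at ht

end PrimitiveTest

section Weak

variable {H : Type} [NormedAddCommGroup H] [InnerProductSpace ℝ H] [CompleteSpace H]
  [SecondCountableTopology H] [MeasurableSpace H] [BorelSpace H]

namespace FPData

variable (D : FPData H)

/-- Lebesgue measure on `[s,T]`. -/
noncomputable abbrev timeMeasure (s : ℝ) : Measure ℝ := volume.restrict (Icc s D.T)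

/-- The measure `κ_t(dx) dt` on `[s,T] × H`. -/
noncomputable abbrev spaceTime (s : ℝ) (κ : ProbabilityTheory.Kernel ℝ H) : Measure (ℝ × H) :=
  (D.timeMeasure s).compProd κ

/-- The time-pointwise formulation of the Fokker–Planck equation. -/
def PointwiseSol (s : ℝ) (ζ : Measure H) (κ : ProbabilityTheory.Kernel ℝ H) : Prop :=
  ∀ u ∈ D.EA, ∀ᵐ t ∂D.timeMeasure s, ∫ y, u (t, y) ∂κ t =
    ∫ y, u (s, y) ∂ζ + ∫ r in Icc s t, (∫ y, D.Lzero u (r, y) ∂κ r)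

/-- The space-time integrated formulation of the Fokker–Planck equation. -/
def IntegratedSol (s : ℝ) (ζ : Measure H) (κ : ProbabilityTheory.Kernel ℝ H) : Prop :=
  ∀ u ∈ D.EA, ∫ p, D.Lzero u p ∂D.spaceTime s κ = -∫ y, u (s, y) ∂ζ

variable {D} {u : ℝ × H → ℝ} {s : ℝ} {ζ : Measure H} [IsProbabilityMeasure ζ]
  {κ : ProbabilityTheory.Kernel ℝ H} [ProbabilityTheory.IsMarkovKernel κ]

theorem ae_timeMeasure_mem_Icc : ∀ᵐ t ∂D.timeMeasure s, t ∈ Icc s D.T :=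
  ae_restrict_mem measurableSet_Icc

theorem ae_timeMeasure_mem_Ioo : ∀ᵐ t ∂D.timeMeasure s, t ∈ Ioo s D.T := by
  rw [timeMeasure, ← restrict_Ioo_eq_restrict_Icc]
  exact ae_restrict_mem measurableSet_Ioo

theorem ae_spaceTime_mem_Ioo (hs : 0 ≤ s) : ∀ᵐ p ∂D.spaceTime s κ, p.1 ∈ Ioo 0 D.T := by
  refine Measure.ae_compProd_of_ae_fst κ (p := fun t => t ∈ Ioo 0 D.T) measurableSet_Ioo ?_
  filter_upwards [ae_timeMeasure_mem_Ioo] with t ht using ⟨hs.trans_lt ht.1, ht.2⟩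

theorem integrableOn_integral {f : ℝ × H → ℝ} (hf : Integrable f (D.spaceTime s κ)) :
    IntegrableOn (fun t => ∫ y, f (t, y) ∂κ t) (Icc s D.T) := by
  have := hf.integral_compProd
  simp only [ProbabilityTheory.Kernel.prodMkLeft_apply,
    ProbabilityTheory.Kernel.const_apply] at this
  exact this

theorem continuous_slice (hu : u ∈ D.EA) {t : ℝ} (ht : t ∈ Icc 0 D.T) :
    Continuous fun y => u (t, y) :=
  (EA_continuousOn hu).comp_continuous (Continuous.prodMk_right t) fun _ => ⟨ht, mem_univ _⟩

theorem integrable_slice (hu : u ∈ D.EA) {t : ℝ} (ht : t ∈ Icc 0 D.T) (ν : Measure H)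
    [IsFiniteMeasure ν] : Integrable (fun y => u (t, y)) ν := by
  obtain ⟨ω, -, -, hω⟩ := EA_bound hu
  exact Integrable.of_bound (continuous_slice hu ht).aestronglyMeasurable (ω t)
    (ae_of_all _ fun y => hω (t, y))

theorem integrable_EA [IsFiniteMeasure (D.spaceTime s κ)] (hs : 0 ≤ s) (hu : u ∈ D.EA) :
    Integrable u (D.spaceTime s κ) := by
  obtain ⟨ω, hω, -, hb⟩ := EA_bound hu
  obtain ⟨M, hM⟩ := exists_bound_time hω
  exact integrable_of_continuousOn_of_bound (ae_spaceTime_mem_Ioo hs) (EA_continuousOn hu)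
    fun p hp => (hb p).trans ((le_abs_self _).trans (hM _ hp))

theorem integral_slice_add {v : ℝ × H → ℝ} (hu : u ∈ D.EA) (hv : v ∈ D.EA) {t : ℝ}
    (ht : t ∈ Icc 0 D.T) (ν : Measure H) [IsFiniteMeasure ν] :
    ∫ y, (u + v) (t, y) ∂ν = ∫ y, u (t, y) ∂ν + ∫ y, v (t, y) ∂ν :=
  integral_add (integrable_slice hu ht ν) (integrable_slice hv ht ν)

theorem abs_integral_slice_le {ω : ℝ → ℝ} (hω : ∀ p : ℝ × H, |u p| ≤ ω p.1) (t : ℝ)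
    (ν : Measure H) [IsProbabilityMeasure ν] : |∫ y, u (t, y) ∂ν| ≤ ω t := by
  have := norm_integral_le_of_norm_le_const (μ := ν) (f := fun y => u (t, y)) (C := ω t)
    (ae_of_all _ fun y => hω (t, y))
  simpa using this

theorem integrable_Lzero_of_integratedSol (hs : s ∈ Ico 0 D.T)
    (h : D.IntegratedSol s ζ κ) (hu : u ∈ D.EA) :
    Integrable (D.Lzero u) (D.spaceTime s κ) := by
  by_contra hn
  have hI := ae_spaceTime_mem_Ioo (D := D) (κ := κ) hs.1
  have hL : D.Lzero (u + fun p => D.T - p.1) =ᵐ[D.spaceTime s κ] D.Lzero u + fun _ => -1 := by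
    filter_upwards [hI] with p hp
    rw [Lzero_add hu EA_time hp, Lzero_time hp]
    rfl
  have hn' : ¬ Integrable (D.Lzero (u + fun p => D.T - p.1)) (D.spaceTime s κ) := by
    rw [integrable_congr hL, integrable_add_iff_integrable_left (integrable_const _)]
    exact hn
  have h1 := h u hu
  have h2 := h _ (EA_add hu EA_time)
  rw [integral_undef hn] at h1
  rw [integral_undef hn', integral_slice_add hu EA_time (Ico_subset_Icc_self hs)] at h2
  have h3 : ∫ _, (D.T - s) ∂ζ = D.T - s := by simp
  have := hs.2
  simp only at h2
  rw [h3] at h2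
  linarith

theorem integratedSol_of_pointwiseSol (hs : s ∈ Ico 0 D.T)
    (hint : ∀ u ∈ D.EA, Integrable (D.Lzero u) (D.spaceTime s κ))
    (h : D.PointwiseSol s ζ κ) : D.IntegratedSol s ζ κ := by
  intro u hu
  obtain ⟨ω, hω, hωT, hb⟩ := EA_bound hu
  set G : ℝ → ℝ := fun r => ∫ y, D.Lzero u (r, y) ∂κ r
  set c := ∫ y, u (s, y) ∂ζ
  have hG : IntegrableOn G (Icc s D.T) := integrableOn_integral (hint u hu)
  have hB := intervalIntegral.continuousOn_primitive_Icc hG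
  have hle : (fun t => max (|c + ∫ r in Icc s t, G r| - ω t) 0)
      =ᵐ[D.timeMeasure s] fun _ => 0 := by
    filter_upwards [h u hu] with t ht
    rw [← ht, max_eq_right]
    exact sub_nonpos.2 (abs_integral_slice_le hb t (κ t))
  have hT := Measure.eqOn_Icc_of_ae_eq volume hs.2.ne hle
    (((continuousOn_const.add hB).abs.sub (hω.mono (Icc_subset_Icc_left hs.1))).sup
      continuousOn_const) continuousOn_const (right_mem_Icc.2 hs.2.le)
  simp only [hωT, sub_zero, max_eq_right_iff, abs_nonpos_iff] at hT
  rw [Measure.integral_compProd (hint u hu)]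
  exact eq_neg_of_add_eq_zero_right hT

theorem pointwiseSol_of_integratedSol (hs : s ∈ Ico 0 D.T)
    (hint : ∀ u ∈ D.EA, Integrable (D.Lzero u) (D.spaceTime s κ))
    (h : D.IntegratedSol s ζ κ) : D.PointwiseSol s ζ κ := by
  intro u hu
  have hI := ae_spaceTime_mem_Ioo (D := D) (κ := κ) hs.1
  set a : ℝ → ℝ := fun r => ∫ y, u (r, y) ∂κ r with ha_def
  set G : ℝ → ℝ := fun r => ∫ y, D.Lzero u (r, y) ∂κ r with hG_def
  set c := ∫ y, u (s, y) ∂ζ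
  have hG : IntegrableOn G (Icc s D.T) := integrableOn_integral (hint u hu)
  have ha : IntegrableOn a (Icc s D.T) := integrableOn_integral (integrable_EA hs.1 hu)
  have hB := intervalIntegral.continuousOn_primitive_Icc hG
  have hBi := hB.integrableOn_compact isCompact_Icc (μ := volume)
  have hcG : ∫ r in Icc s D.T, G r = -c := by
    rw [← h u hu, Measure.integral_compProd (hint u hu)]
  have hzero := ae_restrict_Icc_eq_zero_of_integral_smooth_mul
    ((ha.sub hBi).sub (integrableOn_const (C := c) (by simp) (by simp))) fun θ hθ => by
      have hθc := hθ.continuous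
      set ψ : ℝ → ℝ := fun t => ∫ v in s..t, θ v with hψ_def
      have hψd (t : ℝ) : HasDerivAt ψ (θ t) t := hθc.integral_hasStrictDerivAt s t |>.hasDerivAt
      have hψ : ContDiff ℝ 1 ψ := by
        rw [contDiff_one_iff_deriv]
        exact ⟨fun t => (hψd t).differentiableAt, by rwa [funext fun t => (hψd t).deriv]⟩
      have hψu := EA_mul_time hψ.contDiffOn hu
      have hw := h _ hψu
      have hψs : ψ s = 0 := by simp [hψ_def]
      have hLψ : D.Lzero (fun p => ψ p.1 * u p) =ᵐ[D.spaceTime s κ]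
          fun p => θ p.1 * u p + ψ p.1 * D.Lzero u p := by
        filter_upwards [hI] with p hp using ((hasLzeroAt hu hp).mul_time (hψd _)).Lzero_eq
      have hi := (hint _ hψu).congr hLψ
      rw [integral_congr_ae hLψ, Measure.integral_compProd hi] at hw
      simp only [hψs, zero_mul, integral_zero, neg_zero] at hw
      have hae : (fun t => ∫ y, (θ t * u (t, y) + ψ t * D.Lzero u (t, y)) ∂κ t)
          =ᵐ[D.timeMeasure s] fun t => θ t * a t + ψ t * G t := by
        filter_upwards [((Measure.integrable_compProd_iff (hint u hu).1).1 (hint u hu)).1,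
          ae_timeMeasure_mem_Icc] with t ht hmem
        rw [integral_add ((integrable_slice hu ⟨hs.1.trans hmem.1, hmem.2⟩ _).const_mul _)
          (ht.const_mul _), integral_const_mul, integral_const_mul]
      have hθa : IntegrableOn (fun t => θ t * a t) (Icc s D.T) :=
        ha.continuousOn_mul hθc.continuousOn isCompact_Icc
      have hψG : IntegrableOn (fun t => ψ t * G t) (Icc s D.T) :=
        hG.continuousOn_mul hψ.continuous.continuousOn isCompact_Icc
      rw [integral_congr_ae hae, integral_add hθa hψG,
        integral_primitive_mul hs.2.le hθc hG, hcG] at hw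
      have hθB : IntegrableOn (fun t => θ t * ∫ r in Icc s t, G r) (Icc s D.T) :=
        hBi.continuousOn_mul hθc.continuousOn isCompact_Icc
      have hθc' : IntegrableOn (fun t => θ t * c) (Icc s D.T) :=
        (hθc.mul continuous_const).integrableOn_Icc
      have : ∫ t in Icc s D.T, θ t * (a t - (∫ r in Icc s t, G r) - c) =
          ∫ t in Icc s D.T, (θ t * a t - (θ t * ∫ r in Icc s t, G r) - θ t * c) := by
        congr 1; ext t; ring
      refine this.trans ?_
      erw [integral_sub (hθa.sub hθB) hθc', integral_sub hθa hθB]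
      rw [integral_mul_const]
      linarith
  filter_upwards [hzero] with t ht
  simp only [Pi.sub_apply] at ht
  linarith

end FPData

end Weak

section SliceIntegrability

variable {H : Type} [NormedAddCommGroup H] [InnerProductSpace ℝ H] [CompleteSpace H]
  [SecondCountableTopology H] [MeasurableSpace H] [BorelSpace H]

namespace FPData

variable {D : FPData H} {u : ℝ × H → ℝ} {s : ℝ} {ζ : Measure H} [IsProbabilityMeasure ζ]
  {κ : ProbabilityTheory.Kernel ℝ H} [ProbabilityTheory.IsMarkovKernel κ]

theorem ae_integrable_slice {E : Type*} [NormedAddCommGroup E] {f : ℝ × H → E}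
    (hf : Integrable f (D.spaceTime s κ)) :
    ∀ᵐ t ∂D.timeMeasure s, Integrable (fun y => f (t, y)) (κ t) :=
  ((Measure.integrable_compProd_iff hf.1).1 hf).1

theorem aestronglyMeasurable_integral {f : ℝ × H → ℝ}
    (hf : AEStronglyMeasurable f (D.spaceTime s κ)) :
    AEStronglyMeasurable (fun t => ∫ y, f (t, y) ∂κ t) (D.timeMeasure s) := by
  have := hf.integral_kernel_compProd
  simp only [ProbabilityTheory.Kernel.prodMkLeft_apply,
    ProbabilityTheory.Kernel.const_apply] at this
  exact this

theorem ae_integrable_Lzero_slice (hs : s ∈ Ico 0 D.T)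
    (hd : D.DriftIntegrable (D.spaceTime s κ)) (h : D.PointwiseSol s ζ κ) (hu : u ∈ D.EA) :
    ∀ᵐ t ∂D.timeMeasure s, Integrable (fun y => D.Lzero u (t, y)) (κ t) := by
  have hI := ae_spaceTime_mem_Ioo (D := D) (κ := κ) hs.1
  have hw := EA_add hu EA_time
  set w : ℝ × H → ℝ := u + fun p => D.T - p.1
  set G : ℝ → ℝ := fun r => ∫ y, D.Lzero u (r, y) ∂κ r
  set G' : ℝ → ℝ := fun r => ∫ y, D.Lzero w (r, y) ∂κ r
  have hval : ∀ᵐ t ∂D.timeMeasure s,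
      (Integrable (fun y => D.Lzero u (t, y)) (κ t) → G' t - G t = -1) ∧
      (¬ Integrable (fun y => D.Lzero u (t, y)) (κ t) → G' t - G t = 0) := by
    filter_upwards [ae_timeMeasure_mem_Ioo] with t ht
    have hL : (fun y => D.Lzero w (t, y)) = (fun y => D.Lzero u (t, y)) + fun _ => -1 := by
      ext y
      have hp : ((t, y) : ℝ × H).1 ∈ Ioo 0 D.T := ⟨hs.1.trans_lt ht.1, ht.2⟩
      rw [Lzero_add hu EA_time hp, Lzero_time hp]
      rfl
    refine ⟨fun hi => ?_, fun hi => ?_⟩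
    · simp only [G', G, hL]
      rw [integral_add' hi (integrable_const _)]
      simp
    · have hi' : ¬ Integrable (fun y => D.Lzero w (t, y)) (κ t) := by
        rwa [hL, integrable_add_iff_integrable_left (integrable_const _)]
      simp only [G', G]
      rw [integral_undef hi, integral_undef hi', sub_zero]
  have hdiff : IntegrableOn (fun t => G' t - G t) (Icc s D.T) := by
    refine Integrable.of_bound
      ((aestronglyMeasurable_integral (aestronglyMeasurable_Lzero hI hd hw)).sub
        (aestronglyMeasurable_integral (aestronglyMeasurable_Lzero hI hd hu))) 1 ?_
    filter_upwards [hval] with t ht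
    by_cases hi : Integrable (fun y => D.Lzero u (t, y)) (κ t)
    · simp [ht.1 hi]
    · simp [ht.2 hi]
  have hone : IntegrableOn (fun _ => (1 : ℝ)) (Icc s D.T) := integrableOn_const (by simp)
  have hzero : (fun t => ∫ r in Icc s t, (G' r - G r + 1)) =ᵐ[D.timeMeasure s] fun _ => 0 := by
    filter_upwards [h u hu, h w hw, ae_timeMeasure_mem_Ioo] with t h1 h2 ht
    have htI : t ∈ Icc 0 D.T := ⟨hs.1.trans ht.1.le, ht.2.le⟩
    rw [integral_slice_add hu EA_time htI,
      integral_slice_add hu EA_time (Ico_subset_Icc_self hs), h1] at h2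
    simp only [integral_const, probReal_univ, smul_eq_mul, one_mul] at h2
    have hdt := hdiff.mono_set (Icc_subset_Icc_right ht.2.le)
    by_cases hi : IntegrableOn G (Icc s t)
    · have hi' : IntegrableOn G' (Icc s t) := by
        refine (hi.add hdt).congr (ae_of_all _ fun r => ?_)
        simp
      rw [integral_add hdt (hone.mono_set (Icc_subset_Icc_right ht.2.le)), integral_sub hi' hi]
      simp only [integral_const, MeasurableSet.univ, measureReal_restrict_apply, univ_inter,
        Real.volume_real_Icc_of_le ht.1.le, smul_eq_mul, mul_one]
      linarith
    · have hi' : ¬ IntegrableOn G' (Icc s t) := fun hi' => hi <| by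
        refine (hi'.sub hdt).congr (ae_of_all _ fun r => ?_)
        simp
      rw [integral_undef hi, integral_undef hi'] at h2
      linarith [ht.1]
  have hT := Measure.eqOn_Icc_of_ae_eq volume hs.2.ne hzero
    (intervalIntegral.continuousOn_primitive_Icc (hdiff.add hone)) continuousOn_const
    (right_mem_Icc.2 hs.2.le)
  have hnn : 0 ≤ᵐ[D.timeMeasure s] fun r => G' r - G r + 1 := by
    filter_upwards [hval] with t ht
    by_cases hi : Integrable (fun y => D.Lzero u (t, y)) (κ t)
    · simp [ht.1 hi]
    · simp [ht.2 hi]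
  filter_upwards [hval, (integral_eq_zero_iff_of_nonneg_ae hnn (hdiff.add hone)).1 hT]
    with t ht h0
  by_contra hi
  rw [ht.2 hi] at h0
  norm_num at h0

theorem cinDAstar_time_smul {k g : H} (hk : (k, g) ∈ D.A.adjoint.graph) :
    D.CinDAstar (fun t => t • k) (fun t => t • g) :=
  ⟨by fun_prop, by fun_prop, fun t _ => D.A.adjoint.graph.smul_mem t hk⟩

theorem ae_integrable_ridgeDrift_slice (hs : s ∈ Ico 0 D.T)
    (hd : D.DriftIntegrable (D.spaceTime s κ)) (h : D.PointwiseSol s ζ κ)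
    {φ : ℝ → ℝ} {f g : ℝ → H} {q q₁ q₂ : ℝ → ℝ} (hφ : ContDiffOn ℝ 1 φ (Icc 0 D.T))
    (hf : D.CinDAstar f g) (hq : IsBoundedProfile q q₁ q₂)
    (hu : (fun p : ℝ × H => φ p.1 * q ⟪p.2, f p.1⟫_ℝ) ∈ D.EA) :
    ∀ᵐ t ∂D.timeMeasure s, Integrable (fun y => D.ridgeDrift φ f q₁ (t, y)) (κ t) := by
  filter_upwards [ae_integrable_Lzero_slice hs hd h hu, ae_timeMeasure_mem_Ioo,
    ae_integrable_slice (integrable_ridgeReg (ae_spaceTime_mem_Ioo hs.1) hd hφ hf hq)]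
    with t h1 ht h2
  refine (h1.sub h2).congr (ae_of_all _ fun y => ?_)
  have hp : ((t, y) : ℝ × H).1 ∈ Ioo 0 D.T := ⟨hs.1.trans_lt ht.1, ht.2⟩
  simp only [Pi.sub_apply]
  rw [(hasLzeroAt_ridge' hφ hf hq hp).Lzero_eq, add_sub_cancel_left]

theorem ae_integrable_inner_slice (hs : s ∈ Ico 0 D.T)
    (hd : D.DriftIntegrable (D.spaceTime s κ)) (h : D.PointwiseSol s ζ κ)
    {k g : H} (hk : (k, g) ∈ D.A.adjoint.graph) :
    ∀ᵐ t ∂D.timeMeasure s, Integrable (fun y => ⟪y, k⟫_ℝ) (κ t) := by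
  have hf := cinDAstar_time_smul hk
  have hφ : ContDiffOn ℝ 1 (fun t => D.T - t) (Icc 0 D.T) := by fun_prop
  have hder (t : ℝ) (ht : t ∈ Icc 0 D.T) :
      derivWithin (fun t : ℝ => t • k) (Icc 0 D.T) t = k := by
    have := ((hasDerivAt_id t).smul_const k).hasDerivWithinAt (s := Icc 0 D.T)
    simpa using this.derivWithin (uniqueDiffOn_Icc D.hT t ht)
  have hT : (fun t => D.T - t) D.T = 0 := sub_self _
  filter_upwards [ae_timeMeasure_mem_Ioo,
    ae_integrable_ridgeDrift_slice hs hd h (q := Real.cos) (φ := fun t => D.T - t)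
      (f := fun t => t • k) hφ hf (IsTrigProfile.isBoundedProfile (Or.inl ⟨rfl, rfl, rfl⟩))
      (EA_cos (φ := fun t => D.T - t) (h := fun t => t • k) hφ hT hf),
    ae_integrable_ridgeDrift_slice hs hd h (q := Real.sin) (φ := fun t => D.T - t)
      (f := fun t => t • k) hφ hf (IsTrigProfile.isBoundedProfile (Or.inr ⟨rfl, rfl, rfl⟩))
      (EA_sin (φ := fun t => D.T - t) (h := fun t => t • k) hφ hT hf)]
    with t ht h1 h2
  have hpos : 0 < D.T - t := sub_pos.2 ht.2
  refine ((h1.norm.add h2.norm).const_mul (D.T - t)⁻¹).mono'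
    (by fun_prop) (ae_of_all _ fun y => ?_)
  simp only [ridgeDrift, hder t ⟨hs.1.trans ht.1.le, ht.2.le⟩, Pi.add_apply, norm_mul, norm_neg,
    Real.norm_eq_abs, abs_of_pos hpos]
  set θ := ⟪y, t • k⟫_ℝ
  have h3 : 1 ≤ |Real.sin θ| + |Real.cos θ| := by
    nlinarith [Real.sin_sq_add_cos_sq θ, abs_nonneg (Real.sin θ), abs_nonneg (Real.cos θ),
      sq_abs (Real.sin θ), sq_abs (Real.cos θ)]
  calc |⟪y, k⟫_ℝ| ≤ (|Real.sin θ| + |Real.cos θ|) * |⟪y, k⟫_ℝ| :=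
        le_mul_of_one_le_left (abs_nonneg _) h3
    _ = _ := by field_simp

end FPData

end SliceIntegrability

section SmoothAbs

open Polynomial

/-- The coefficients `centralBinom j / 4 ^ j` of the power series of `(1 - x)^(-1/2)`. -/
noncomputable def invSqrtCoeff : ℕ → ℝ
  | 0 => 1
  | N + 1 => invSqrtCoeff N * ((2 * N + 1) / (2 * N + 2))

/-- The Taylor polynomials of `(1 - x)^(-1/2)` at `0`. -/
noncomputable def invSqrtPoly : ℕ → ℝ[X]
  | 0 => 0
  | N + 1 => invSqrtPoly N + C (invSqrtCoeff N) * X ^ N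

/-- The Taylor polynomials of `(1 - x)^(1/2)` at `0`. -/
noncomputable def sqrtPoly : ℕ → ℝ[X]
  | 0 => 1
  | N + 1 => sqrtPoly N - C (invSqrtCoeff N / (2 * N + 2)) * X ^ (N + 1)

theorem invSqrtCoeff_pos (N : ℕ) : 0 < invSqrtCoeff N := by
  induction N with
  | zero => simp [invSqrtCoeff]
  | succ N ih => rw [invSqrtCoeff]; positivity

theorem invSqrtCoeff_sq_mul_le (N : ℕ) : invSqrtCoeff N ^ 2 * (2 * N + 1) ≤ 1 := by
  induction N with
  | zero => simp [invSqrtCoeff]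
  | succ N ih =>
    refine le_trans ?_ ih
    rw [invSqrtCoeff, mul_pow, mul_assoc]
    refine mul_le_mul_of_nonneg_left ?_ (sq_nonneg _)
    rw [div_pow, div_mul_eq_mul_div, div_le_iff₀ (by positivity)]
    push_cast
    have : (0 : ℝ) ≤ N := N.cast_nonneg
    nlinarith

theorem sqrtPoly_eval_zero (N : ℕ) : (sqrtPoly N).eval 0 = 1 := by
  induction N with
  | zero => simp [sqrtPoly]
  | succ N ih => simp [sqrtPoly, ih]

theorem sqrtPoly_eval_one (N : ℕ) : (sqrtPoly N).eval 1 = invSqrtCoeff N := by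
  induction N with
  | zero => simp [sqrtPoly, invSqrtCoeff]
  | succ N ih =>
    simp only [sqrtPoly, eval_sub, ih, eval_mul, eval_C, eval_pow, eval_X, one_pow, mul_one,
      invSqrtCoeff]
    field_simp
    ring

theorem derivative_sqrtPoly (N : ℕ) : derivative (sqrtPoly N) = C (-1 / 2) * invSqrtPoly N := by
  induction N with
  | zero => simp [sqrtPoly, invSqrtPoly]
  | succ N ih =>
    rw [sqrtPoly, derivative_sub, ih, derivative_C_mul_X_pow, invSqrtPoly, mul_add, ← mul_assoc,
      ← C_mul, sub_eq_add_neg, ← neg_mul, ← C_neg]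
    congr 3
    push_cast
    field_simp

theorem invSqrtPoly_nonneg (N : ℕ) {x : ℝ} (hx : 0 ≤ x) : 0 ≤ (invSqrtPoly N).eval x := by
  induction N with
  | zero => simp [invSqrtPoly]
  | succ N ih =>
    have := (invSqrtCoeff_pos N).le
    simp only [invSqrtPoly, eval_add, eval_mul, eval_C, eval_pow, eval_X]
    positivity

theorem invSqrtPoly_ode (N : ℕ) (x : ℝ) :
    x * (2 * (1 - x) * (derivative (invSqrtPoly N)).eval x - (invSqrtPoly N).eval x) =
      -(2 * N * invSqrtCoeff N * x ^ N) := by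
  induction N with
  | zero => simp [invSqrtPoly]
  | succ N ih =>
    have hx : (N : ℝ) * x ^ (N - 1) * x = N * x ^ N := by
      cases N with
      | zero => simp
      | succ n => simp [pow_succ, mul_assoc]
    simp only [invSqrtPoly, derivative_add, derivative_C_mul_X_pow, eval_add, eval_mul, eval_C,
      eval_pow, eval_X, invSqrtCoeff]
    push_cast
    have : 2 * ((N : ℝ) + 1) * (invSqrtCoeff N * ((2 * N + 1) / (2 * N + 2))) =
        (2 * N + 1) * invSqrtCoeff N := by field_simp
    rw [this, pow_succ]
    linear_combination ih + 2 * (1 - x) * invSqrtCoeff N * hx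

theorem one_sub_mul_invSqrtPoly_sq_le (N : ℕ) {x : ℝ} (hx : x ∈ Icc (0 : ℝ) 1) :
    (1 - x) * (invSqrtPoly N).eval x ^ 2 ≤ 1 := by
  have hd (y : ℝ) : HasDerivAt (fun y => (1 - y) * (invSqrtPoly N).eval y ^ 2)
      ((invSqrtPoly N).eval y *
        (2 * (1 - y) * (derivative (invSqrtPoly N)).eval y - (invSqrtPoly N).eval y)) y := by
    have h := ((hasDerivAt_id y).const_sub 1).mul (((invSqrtPoly N).hasDerivAt y).pow 2)
    refine h.congr_deriv ?_
    simp
    ring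
  have hanti : AntitoneOn (fun y => (1 - y) * (invSqrtPoly N).eval y ^ 2) (Icc 0 1) := by
    refine antitoneOn_of_deriv_nonpos (convex_Icc 0 1) (by fun_prop) (by fun_prop) fun y hy => ?_
    rw [interior_Icc] at hy
    rw [(hd y).deriv]
    refine mul_nonpos_of_nonneg_of_nonpos (invSqrtPoly_nonneg N hy.1.le) ?_
    refine nonpos_of_mul_nonpos_right (a := y) ?_ hy.1
    rw [invSqrtPoly_ode, neg_nonpos]
    have := (invSqrtCoeff_pos N).le
    have := hy.1.le
    positivity
  refine (hanti (left_mem_Icc.2 zero_le_one) hx hx.1).trans ?_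
  cases N with
  | zero => simp [invSqrtPoly]
  | succ N =>
    suffices h : ∀ N, (invSqrtPoly (N + 1)).eval 0 = 1 by simp [h]
    intro N
    induction N with
    | zero => simp [invSqrtPoly, invSqrtCoeff]
    | succ N ih => rw [invSqrtPoly]; simp [ih]

/-- Trigonometric polynomials converging to `|y|`, with uniform bounds on two derivatives. -/
noncomputable def trigAbs (n : ℕ) (y : ℝ) : ℝ :=
  (n + 1) * (sqrtPoly ((n + 1) ^ 2)).eval (Real.cos ((n + 1 : ℝ)⁻¹ * y) ^ 2)

/-- The first derivative of `trigAbs`. -/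
noncomputable def trigAbs₁ (n : ℕ) (y : ℝ) : ℝ :=
  Real.sin ((n + 1 : ℝ)⁻¹ * y) * Real.cos ((n + 1 : ℝ)⁻¹ * y) *
    (invSqrtPoly ((n + 1) ^ 2)).eval (Real.cos ((n + 1 : ℝ)⁻¹ * y) ^ 2)

/-- The second derivative of `trigAbs`. -/
noncomputable def trigAbs₂ (n : ℕ) (y : ℝ) : ℝ :=
  (n + 1 : ℝ)⁻¹ * ((Real.cos ((n + 1 : ℝ)⁻¹ * y) ^ 2 - 1) *
    (invSqrtPoly ((n + 1) ^ 2)).eval (Real.cos ((n + 1 : ℝ)⁻¹ * y) ^ 2) +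
      2 * (n + 1) ^ 2 * invSqrtCoeff ((n + 1) ^ 2) *
        (Real.cos ((n + 1 : ℝ)⁻¹ * y) ^ 2) ^ ((n + 1) ^ 2))

theorem hasDerivAt_trigAbs (n : ℕ) (y : ℝ) : HasDerivAt (trigAbs n) (trigAbs₁ n y) y := by
  have hl : HasDerivAt (fun y => (n + 1 : ℝ)⁻¹ * y) (n + 1 : ℝ)⁻¹ y := by
    simpa using (hasDerivAt_id y).const_mul (n + 1 : ℝ)⁻¹
  have h := (((sqrtPoly ((n + 1) ^ 2)).hasDerivAt _).comp y (hl.cos.pow 2)).const_mul (n + 1 : ℝ)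
  refine h.congr_deriv ?_
  rw [derivative_sqrtPoly, trigAbs₁]
  simp only [eval_mul, eval_C, Pi.pow_apply]
  push_cast
  field_simp

theorem hasDerivAt_trigAbs₁ (n : ℕ) (y : ℝ) : HasDerivAt (trigAbs₁ n) (trigAbs₂ n y) y := by
  have hl : HasDerivAt (fun y => (n + 1 : ℝ)⁻¹ * y) (n + 1 : ℝ)⁻¹ y := by
    simpa using (hasDerivAt_id y).const_mul (n + 1 : ℝ)⁻¹
  have h := (hl.sin.mul hl.cos).mul
    (((invSqrtPoly ((n + 1) ^ 2)).hasDerivAt _).comp y (hl.cos.pow 2))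
  refine h.congr_deriv ?_
  have hode := invSqrtPoly_ode ((n + 1) ^ 2) (Real.cos ((n + 1 : ℝ)⁻¹ * y) ^ 2)
  have hsc := Real.sin_sq_add_cos_sq ((n + 1 : ℝ)⁻¹ * y)
  rw [trigAbs₂]
  simp only [Pi.pow_apply, Pi.mul_apply, Function.comp_apply]
  push_cast at hode ⊢
  generalize (invSqrtPoly ((n + 1) ^ 2)).eval (Real.cos ((n + 1 : ℝ)⁻¹ * y) ^ 2) = P at *
  generalize (derivative (invSqrtPoly ((n + 1) ^ 2))).eval (Real.cos ((n + 1 : ℝ)⁻¹ * y) ^ 2) = P'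
    at *
  generalize (Real.cos ((n + 1 : ℝ)⁻¹ * y) ^ 2) ^ ((n + 1) ^ 2) = Z at *
  generalize Real.cos ((n + 1 : ℝ)⁻¹ * y) = c at *
  generalize Real.sin ((n + 1 : ℝ)⁻¹ * y) = σ at *
  generalize (n + 1 : ℝ)⁻¹ = ν at *
  linear_combination (-ν) * hode + (-ν * P - 2 * c ^ 2 * P' * ν) * hsc

theorem cos_sq_mem (θ : ℝ) : Real.cos θ ^ 2 ∈ Icc (0 : ℝ) 1 :=
  ⟨sq_nonneg _, Real.cos_sq_le_one θ⟩

theorem abs_trigAbs₁_le (n : ℕ) (y : ℝ) : |trigAbs₁ n y| ≤ 1 := by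
  rw [← sq_le_one_iff_abs_le_one, trigAbs₁]
  set θ := (n + 1 : ℝ)⁻¹ * y
  have h := one_sub_mul_invSqrtPoly_sq_le ((n + 1) ^ 2) (cos_sq_mem θ)
  have hsc := Real.sin_sq_add_cos_sq θ
  have h0 : 0 ≤ (1 - Real.cos θ ^ 2) * eval (Real.cos θ ^ 2) (invSqrtPoly ((n + 1) ^ 2)) ^ 2 :=
    mul_nonneg (by linarith [sq_nonneg (Real.sin θ)]) (sq_nonneg _)
  rw [mul_pow, mul_pow, mul_right_comm, show Real.sin θ ^ 2 = 1 - Real.cos θ ^ 2 by linarith]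
  exact mul_le_one₀ h (cos_sq_mem θ).1 (cos_sq_mem θ).2

theorem invSqrtCoeff_mul_le (n : ℕ) : (n + 1) * invSqrtCoeff ((n + 1) ^ 2) ≤ 1 := by
  have h := invSqrtCoeff_sq_mul_le ((n + 1) ^ 2)
  have hp := (invSqrtCoeff_pos ((n + 1) ^ 2)).le
  have hn : (0 : ℝ) ≤ n := n.cast_nonneg
  push_cast at h
  rw [← sq_le_one_iff₀ (by positivity)]
  nlinarith [sq_nonneg (invSqrtCoeff ((n + 1) ^ 2)),
    mul_nonneg (sq_nonneg (invSqrtCoeff ((n + 1) ^ 2))) (sq_nonneg ((n : ℝ) + 1))]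

theorem abs_trigAbs₂_le (n : ℕ) (y : ℝ) : |trigAbs₂ n y| ≤ 3 := by
  rw [trigAbs₂]
  set x := Real.cos ((n + 1 : ℝ)⁻¹ * y) ^ 2 with hx_def
  have hx : x ∈ Icc (0 : ℝ) 1 := cos_sq_mem _
  have h := one_sub_mul_invSqrtPoly_sq_le ((n + 1) ^ 2) hx
  have hP := invSqrtPoly_nonneg ((n + 1) ^ 2) hx.1
  set P := eval x (invSqrtPoly ((n + 1) ^ 2))
  have h1 : (1 - x) * P ≤ 1 := by
    rw [← sq_le_one_iff₀ (mul_nonneg (by linarith [hx.2]) hP)]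
    nlinarith [mul_nonneg hx.1 (mul_nonneg (sub_nonneg.2 hx.2) (sq_nonneg P)), hx.1, hx.2]
  have h2 := mul_nonneg (sub_nonneg.2 hx.2) hP
  have hZ0 : 0 ≤ x ^ ((n + 1) ^ 2) := pow_nonneg hx.1 _
  have hZ1 : x ^ ((n + 1) ^ 2) ≤ 1 := pow_le_one₀ hx.1 hx.2
  set Z := x ^ ((n + 1) ^ 2)
  have hc := invSqrtCoeff_mul_le n
  have hc0 := (invSqrtCoeff_pos ((n + 1) ^ 2)).le
  set c := invSqrtCoeff ((n + 1) ^ 2)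
  have hn : (0 : ℝ) < (n : ℝ) + 1 := by positivity
  have hn1 : (n + 1 : ℝ)⁻¹ ≤ 1 := inv_le_one_of_one_le₀ (by linarith [n.cast_nonneg (α := ℝ)])
  have hn0 : 0 ≤ (n + 1 : ℝ)⁻¹ := by positivity
  have heq : (n + 1 : ℝ)⁻¹ * ((x - 1) * P + 2 * (n + 1) ^ 2 * c * Z) =
      -((n + 1 : ℝ)⁻¹ * ((1 - x) * P)) + 2 * (((n + 1) * c) * Z) := by
    field_simp
    ring
  have h3 := mul_le_one₀ hn1 h2 h1
  have h4 := mul_nonneg hn0 h2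
  have h5 := mul_le_one₀ hc hZ0 hZ1
  have h6 := mul_nonneg (mul_nonneg hn.le hc0) hZ0
  rw [heq, abs_le]
  constructor <;> linarith

theorem trigAbs_zero_le (n : ℕ) : trigAbs n 0 ≤ 1 := by
  simpa [trigAbs, sqrtPoly_eval_one] using invSqrtCoeff_mul_le n

theorem abs_sin_le_sqrtPoly_cos_sq (N : ℕ) (θ : ℝ) :
    |Real.sin θ| ≤ (sqrtPoly N).eval (Real.cos θ ^ 2) := by
  have key : ∀ θ ∈ Icc 0 (Real.pi / 2), Real.sin θ ≤ (sqrtPoly N).eval (Real.cos θ ^ 2) := by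
    have hd (θ : ℝ) : HasDerivAt (fun θ => (sqrtPoly N).eval (Real.cos θ ^ 2) - Real.sin θ)
        (Real.cos θ * (Real.sin θ * (invSqrtPoly N).eval (Real.cos θ ^ 2) - 1)) θ := by
      have h := (((sqrtPoly N).hasDerivAt _).comp θ ((Real.hasDerivAt_cos θ).pow 2)).sub
        (Real.hasDerivAt_sin θ)
      refine h.congr_deriv ?_
      rw [derivative_sqrtPoly]
      simp only [eval_mul, eval_C, Pi.pow_apply]
      push_cast
      ring
    have hanti : AntitoneOn (fun θ => (sqrtPoly N).eval (Real.cos θ ^ 2) - Real.sin θ)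
        (Icc 0 (Real.pi / 2)) := by
      refine antitoneOn_of_deriv_nonpos (convex_Icc _ _)
        (fun θ _ => (hd θ).continuousAt.continuousWithinAt)
        (fun θ _ => (hd θ).differentiableAt.differentiableWithinAt) fun θ hθ => ?_
      rw [interior_Icc] at hθ
      rw [(hd θ).deriv]
      refine mul_nonpos_of_nonneg_of_nonpos
        (Real.cos_nonneg_of_mem_Icc ⟨by linarith [hθ.1, Real.pi_pos], hθ.2.le⟩) ?_
      have h := one_sub_mul_invSqrtPoly_sq_le N (cos_sq_mem θ)
      have h0 := mul_nonneg (Real.sin_nonneg_of_nonneg_of_le_pi hθ.1.le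
        (by linarith [hθ.2, Real.pi_pos])) (invSqrtPoly_nonneg N (cos_sq_mem θ).1)
      rw [sub_nonpos, ← sq_le_one_iff₀ h0, mul_pow,
        show Real.sin θ ^ 2 = 1 - Real.cos θ ^ 2 by linarith [Real.sin_sq_add_cos_sq θ]]
      exact h
    intro θ hθ
    have := hanti hθ (right_mem_Icc.2 (by positivity)) hθ.2
    simp only [Real.cos_pi_div_two, Real.sin_pi_div_two, ne_eq, OfNat.ofNat_ne_zero,
      not_false_eq_true, zero_pow, sqrtPoly_eval_zero, sub_self, sub_nonneg] at this
    exact this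
  have h := key (Real.arcsin |Real.sin θ|)
    ⟨Real.arcsin_nonneg.2 (abs_nonneg _), Real.arcsin_le_pi_div_two _⟩
  have hs : Real.sin (Real.arcsin |Real.sin θ|) = |Real.sin θ| :=
    Real.sin_arcsin (by linarith [abs_nonneg (Real.sin θ)]) (Real.abs_sin_le_one θ)
  have hc : Real.cos (Real.arcsin |Real.sin θ|) ^ 2 = Real.cos θ ^ 2 := by
    rw [Real.cos_sq', Real.cos_sq', hs, sq_abs]
  rwa [hs, hc] at h

theorem abs_mul_sin_le_trigAbs (n : ℕ) (y : ℝ) :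
    |(n + 1) * Real.sin ((n + 1 : ℝ)⁻¹ * y)| ≤ trigAbs n y := by
  rw [abs_mul, abs_of_nonneg (by positivity)]
  exact mul_le_mul_of_nonneg_left (abs_sin_le_sqrtPoly_cos_sq _ _) (by positivity)

theorem trigAbs_nonneg (n : ℕ) (y : ℝ) : 0 ≤ trigAbs n y :=
  (abs_nonneg _).trans (abs_mul_sin_le_trigAbs n y)

theorem trigAbs_le (n : ℕ) (y : ℝ) : trigAbs n y ≤ 1 + |y| := by
  have h := Convex.norm_image_sub_le_of_norm_hasDerivWithin_le (s := univ) (C := 1) (x := 0)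
    (y := y) (fun x _ => (hasDerivAt_trigAbs n x).hasDerivWithinAt)
    (fun x _ => abs_trigAbs₁_le n x) convex_univ (mem_univ _) (mem_univ _)
  rw [sub_zero, one_mul, Real.norm_eq_abs, Real.norm_eq_abs] at h
  linarith [le_abs_self (trigAbs n y - trigAbs n 0), trigAbs_zero_le n]

theorem tendsto_mul_sin_div (y : ℝ) :
    Tendsto (fun n : ℕ => |(n + 1) * Real.sin ((n + 1 : ℝ)⁻¹ * y)|) atTop (𝓝 |y|) := by
  refine Tendsto.abs ?_
  rcases eq_or_ne y 0 with rfl | hy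
  · simp
  have hd : HasDerivAt (fun x => Real.sin (x * y)) y 0 := by
    have := ((hasDerivAt_id (0 : ℝ)).mul_const y).sin
    simpa using this
  have h := hd.tendsto_slope_zero
  have hlim : Tendsto (fun n : ℕ => (n + 1 : ℝ)⁻¹) atTop (𝓝[≠] 0) := by
    refine tendsto_nhdsWithin_iff.2 ⟨?_, Eventually.of_forall fun n => ?_⟩
    · simpa using tendsto_one_div_add_atTop_nhds_zero_nat (𝕜 := ℝ)
    · have : (n + 1 : ℝ) ≠ 0 := by positivity
      simpa using this
  refine (h.comp hlim).congr fun n => ?_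
  simp

theorem continuous_trigAbs₂ (n : ℕ) : Continuous (trigAbs₂ n) := by
  unfold trigAbs₂
  fun_prop

end SmoothAbs

section UniformMoments

variable {H : Type} [NormedAddCommGroup H] [InnerProductSpace ℝ H] [CompleteSpace H]
  [SecondCountableTopology H] [MeasurableSpace H] [BorelSpace H]

namespace FPData

variable {D : FPData H} {s : ℝ} {ζ : Measure H} [IsProbabilityMeasure ζ]
  {κ : ProbabilityTheory.Kernel ℝ H} [ProbabilityTheory.IsMarkovKernel κ] {k g : H}

theorem isBoundedProfile_trigAbs (n : ℕ) :
    IsBoundedProfile (trigAbs n) (trigAbs₁ n) (trigAbs₂ n) where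
  deriv₀ := hasDerivAt_trigAbs n
  deriv₁ := hasDerivAt_trigAbs₁ n
  cont₂ := continuous_trigAbs₂ n
  bound := by
    obtain ⟨M, hM⟩ := (isCompact_Icc (a := (0 : ℝ)) (b := 1)).exists_bound_of_continuousOn
      (sqrtPoly ((n + 1) ^ 2)).continuous.continuousOn
    refine ⟨max ((n + 1) * M) 3, fun y => ⟨le_max_of_le_left ?_,
      le_max_of_le_right ((abs_trigAbs₁_le n y).trans (by norm_num)),
      le_max_of_le_right (abs_trigAbs₂_le n y)⟩⟩
    rw [trigAbs, abs_mul, abs_of_nonneg (by positivity)]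
    exact mul_le_mul_of_nonneg_left (hM _ (cos_sq_mem _)) (by positivity)

theorem cinDAstar_smul_const (hk : (k, g) ∈ D.A.adjoint.graph) (a : ℝ) :
    D.CinDAstar (fun _ => a • k) (fun _ => a • g) :=
  cinDAstar_const (D.A.adjoint.graph.smul_mem a hk)

theorem EA_cos_mul_cos_pow {φ : ℝ → ℝ} (hφ : ContDiffOn ℝ 1 φ (Icc 0 D.T)) (hT : φ D.T = 0)
    (hk : (k, g) ∈ D.A.adjoint.graph) (c : ℝ) (m : ℕ) (a : ℝ) :
    (fun p : ℝ × H => φ p.1 * (Real.cos (a * ⟪p.2, k⟫_ℝ) * Real.cos (c * ⟪p.2, k⟫_ℝ) ^ m)) ∈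
      D.EA := by
  induction m generalizing a with
  | zero =>
    have h := EA_cos (φ := φ) (h := fun _ => a • k) hφ hT (cinDAstar_smul_const hk a)
    simpa only [inner_smul_right, pow_zero, mul_one] using h
  | succ m ih =>
    have h := EA_smul (1 / 2) (EA_add (ih (a + c)) (ih (a - c)))
    convert h using 1
    ext p
    simp only [Pi.smul_apply, Pi.add_apply, smul_eq_mul, add_mul, sub_mul, Real.cos_add,
      Real.cos_sub]
    ring

theorem EA_polynomial_cos_sq {φ : ℝ → ℝ} (hφ : ContDiffOn ℝ 1 φ (Icc 0 D.T)) (hT : φ D.T = 0)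
    (hk : (k, g) ∈ D.A.adjoint.graph) (c : ℝ) (P : Polynomial ℝ) :
    (fun p : ℝ × H => φ p.1 * P.eval (Real.cos (c * ⟪p.2, k⟫_ℝ) ^ 2)) ∈ D.EA := by
  induction P using Polynomial.induction_on' with
  | add P Q hP hQ =>
    convert EA_add hP hQ using 1
    ext p
    simp [mul_add]
  | monomial m a =>
    convert EA_smul a (EA_cos_mul_cos_pow hφ hT hk c (2 * m) 0) using 1
    ext p
    simp [← pow_mul]
    ring

theorem EA_trigAbs {φ : ℝ → ℝ} (hφ : ContDiffOn ℝ 1 φ (Icc 0 D.T)) (hT : φ D.T = 0)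
    (hk : (k, g) ∈ D.A.adjoint.graph) (n : ℕ) :
    (fun p : ℝ × H => φ p.1 * trigAbs n ⟪p.2, k⟫_ℝ) ∈ D.EA := by
  convert EA_smul (n + 1 : ℝ)
    (EA_polynomial_cos_sq hφ hT hk (n + 1 : ℝ)⁻¹ (sqrtPoly ((n + 1) ^ 2))) using 1
  ext p
  simp only [trigAbs, Pi.smul_apply, smul_eq_mul]
  ring

theorem abs_setIntegral_Lzero_le {W : ℝ × H → ℝ} (hW : Integrable W (D.spaceTime s κ))
    (hW₀ : 0 ≤ W) {t : ℝ} (ht : t ∈ Icc s D.T)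
    (hb : ∀ p : ℝ × H, p.1 ∈ Ioo s t → |D.Lzero u p| ≤ W p) :
    |∫ r in Icc s t, ∫ y, D.Lzero u (r, y) ∂κ r| ≤ ∫ p, W p ∂D.spaceTime s κ := by
  have hG := integrableOn_integral hW
  have hsub : Icc s t ⊆ Icc s D.T := Icc_subset_Icc_right ht.2
  have hIoo : ∀ᵐ r ∂volume.restrict (Icc s t), r ∈ Ioo s t := by
    rw [← restrict_Ioo_eq_restrict_Icc]
    exact ae_restrict_mem measurableSet_Ioo
  calc |∫ r in Icc s t, ∫ y, D.Lzero u (r, y) ∂κ r|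
      ≤ ∫ r in Icc s t, ∫ y, W (r, y) ∂κ r := by
        rw [← Real.norm_eq_abs]
        refine norm_integral_le_of_norm_le (hG.mono_set hsub) ?_
        filter_upwards [hIoo, ae_restrict_of_ae_restrict_of_subset hsub (ae_integrable_slice hW)]
          with r hr hint
        exact norm_integral_le_of_norm_le hint (Eventually.of_forall fun y => hb (r, y) hr)
    _ ≤ ∫ r in Icc s D.T, ∫ y, W (r, y) ∂κ r :=
        setIntegral_mono_set hG (Eventually.of_forall fun r => integral_nonneg fun y => hW₀ _)
          hsub.eventuallyLE
    _ = ∫ p, W p ∂D.spaceTime s κ := (Measure.integral_compProd hW).symm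

theorem exists_cutoff {a : ℝ} (ha : a < D.T) : ∃ φ : ℝ → ℝ, ContDiff ℝ 1 φ ∧ φ D.T = 0 ∧
    ∀ t ≤ a, φ t = 1 := by
  refine ⟨fun t : ℝ => Real.smoothTransition ((D.T - t) / (D.T - a)),
    Real.smoothTransition.contDiff.comp (f := fun t : ℝ => (D.T - t) / (D.T - a)) (by fun_prop),
    by simp, fun t ht =>
      Real.smoothTransition.one_of_one_le ?_⟩
  rw [one_le_div (by linarith)]
  linarith

theorem exists_abs_integral_trigAbs_sub_le (hs : s ∈ Ico 0 D.T)
    (hd : D.DriftIntegrable (D.spaceTime s κ)) (h : D.PointwiseSol s ζ κ)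
    (hk : (k, g) ∈ D.A.adjoint.graph) :
    ∃ M, ∀ (n : ℕ) (a : ℝ), a < D.T → ∃ c, ∀ᵐ t ∂D.timeMeasure s, t < a →
      |∫ y, trigAbs n ⟪y, k⟫_ℝ ∂κ t - c| ≤ M := by
  have hI : ∀ᵐ p ∂D.spaceTime s κ, p.1 ∈ Ioo 0 D.T := ae_spaceTime_mem_Ioo hs.1
  have hkc := cinDAstar_const hk
  set W : ℝ × H → ℝ := fun p => 3 * ((1 / 2) * ‖D.sqrtC k‖ ^ 2) +
    (|⟪p.2, g⟫_ℝ| + |⟪D.F p, k⟫_ℝ|) with hW_def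
  have hW : Integrable W (D.spaceTime s κ) :=
    (integrable_const _).add ((hd.integrable_inner hI hkc).abs.add
      (integrable_inner_F hI hd hkc.1.continuousOn).abs)
  refine ⟨∫ p, W p ∂D.spaceTime s κ, fun n a ha => ?_⟩
  obtain ⟨φ, hφ, hφT, hφ1⟩ := D.exists_cutoff ha
  have hu : (fun p : ℝ × H => φ p.1 * trigAbs n ⟪p.2, k⟫_ℝ) ∈ D.EA :=
    EA_trigAbs hφ.contDiffOn hφT hk n
  set u : ℝ × H → ℝ := fun p => φ p.1 * trigAbs n ⟪p.2, k⟫_ℝ with hu_def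
  refine ⟨∫ y, u (s, y) ∂ζ, ?_⟩
  filter_upwards [h u hu, ae_timeMeasure_mem_Ioo] with t ht hts hta
  have hut : ∫ y, u (t, y) ∂κ t = ∫ y, trigAbs n ⟪y, k⟫_ℝ ∂κ t := by
    simp [hu_def, hφ1 t hta.le]
  rw [← hut, ht, add_sub_cancel_left]
  refine abs_setIntegral_Lzero_le hW (fun p => by positivity) ⟨hts.1.le, hts.2.le⟩ fun p hp => ?_
  have hpT : p.1 ∈ Ioo 0 D.T := ⟨hs.1.trans_lt hp.1, hp.2.trans hts.2⟩
  have hL := (hasLzeroAt_ridge' (h := fun _ => k) hφ.contDiffOn hkc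
    (isBoundedProfile_trigAbs n) hpT).Lzero_eq
  have hφ' : derivWithin φ (Icc 0 D.T) p.1 = 0 := by
    refine (hφ.contDiffOn.hasDerivAt_derivWithin_Icc hpT).unique ?_
    refine (hasDerivAt_const p.1 (1 : ℝ)).congr_of_eventuallyEq ?_
    filter_upwards [Iio_mem_nhds (hp.2.trans hta)] with r hr using hφ1 r (le_of_lt hr)
  have hL' : D.Lzero u p = trigAbs₂ n ⟪p.2, k⟫_ℝ * ((1 / 2) * ‖D.sqrtC k‖ ^ 2) +
      trigAbs₁ n ⟪p.2, k⟫_ℝ * (⟪p.2, g⟫_ℝ + ⟪D.F p, k⟫_ℝ) := by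
    rw [hu_def, hL, ridgeReg, ridgeDrift, hφ', hφ1 p.1 (hp.2.trans hta).le]
    simp
  rw [hL']
  refine (abs_add_le _ _).trans (add_le_add ?_ ?_)
  · rw [abs_mul, abs_of_nonneg (a := 1 / 2 * _) (by positivity)]
    exact mul_le_mul_of_nonneg_right (abs_trigAbs₂_le _ _) (by positivity)
  · rw [abs_mul]
    exact (mul_le_of_le_one_left (abs_nonneg _) (abs_trigAbs₁_le _ _)).trans (abs_add_le _ _)

theorem lintegral_enorm_inner_le_of_trigAbs {ν : Measure H} [IsProbabilityMeasure ν] {M : ℝ}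
    (h : ∀ n : ℕ, ∫ y, trigAbs n ⟪y, k⟫_ℝ ∂ν ≤ M) :
    ∫⁻ y, ‖⟪y, k⟫_ℝ‖ₑ ∂ν ≤ ENNReal.ofReal M := by
  have hle (n : ℕ) : ∫⁻ y, ‖(n + 1) * Real.sin ((n + 1 : ℝ)⁻¹ * ⟪y, k⟫_ℝ)‖ₑ ∂ν ≤
      ENNReal.ofReal M := by
    obtain ⟨B, hB⟩ := (isBoundedProfile_trigAbs n).bound
    have hc : Continuous fun y : H => trigAbs n ⟪y, k⟫_ℝ :=
      (isBoundedProfile_trigAbs n).continuous.1.comp (by fun_prop)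
    have hi : Integrable (fun y => trigAbs n ⟪y, k⟫_ℝ) ν :=
      Integrable.of_bound hc.aestronglyMeasurable B (Eventually.of_forall fun y => (hB _).1)
    refine le_trans ?_ (ENNReal.ofReal_le_ofReal (h n))
    rw [ofReal_integral_eq_lintegral_ofReal hi (Eventually.of_forall fun y => trigAbs_nonneg _ _)]
    refine lintegral_mono fun y => ?_
    rw [Real.enorm_eq_ofReal_abs]
    exact ENNReal.ofReal_le_ofReal (abs_mul_sin_le_trigAbs n _)
  calc ∫⁻ y, ‖⟪y, k⟫_ℝ‖ₑ ∂ν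
      = ∫⁻ y, liminf (fun n : ℕ => ‖(n + 1) * Real.sin ((n + 1 : ℝ)⁻¹ * ⟪y, k⟫_ℝ)‖ₑ) atTop ∂ν := by
        refine lintegral_congr fun y => (Tendsto.liminf_eq ?_).symm
        simp only [Real.enorm_eq_ofReal_abs]
        exact ENNReal.tendsto_ofReal (tendsto_mul_sin_div _)
    _ ≤ liminf (fun n : ℕ =>
          ∫⁻ y, ‖(n + 1) * Real.sin ((n + 1 : ℝ)⁻¹ * ⟪y, k⟫_ℝ)‖ₑ ∂ν) atTop :=
        lintegral_liminf_le fun n => by fun_prop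
    _ ≤ ENNReal.ofReal M :=
        liminf_le_of_le (by isBoundedDefault) fun b hb => by
          obtain ⟨n, hn⟩ := hb.exists
          exact hn.trans (hle n)

theorem exists_ae_lintegral_inner_le (hs : s ∈ Ico 0 D.T)
    (hd : D.DriftIntegrable (D.spaceTime s κ)) (h : D.PointwiseSol s ζ κ)
    (hk : (k, g) ∈ D.A.adjoint.graph) :
    ∃ j : ℕ, ∀ᵐ t ∂D.timeMeasure s, ∫⁻ y, ‖⟪y, k⟫_ℝ‖ₑ ∂κ t ≤ j := by
  obtain ⟨M, hM⟩ := exists_abs_integral_trigAbs_sub_le hs hd h hk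
  have ha (m : ℕ) : D.T - 1 / (m + 1 : ℝ) < D.T := sub_lt_self _ (by positivity)
  choose c hc using fun n m : ℕ => hM n _ (ha m)
  have hall := ae_all_iff.2 fun n => ae_all_iff.2 fun m => hc n m
  have : (ae (D.timeMeasure s)).NeBot := by
    rw [ae_neBot, Ne, Measure.restrict_eq_zero, Real.volume_Icc, ENNReal.ofReal_eq_zero, not_le]
    linarith [hs.2]
  obtain ⟨r, hr, hri, hrT⟩ := (hall.and
    ((ae_integrable_inner_slice hs hd h hk).and (ae_timeMeasure_mem_Ioo (D := D)))).exists
  obtain ⟨j, hj⟩ := exists_nat_ge (2 * M + (1 + ∫ y, |⟪y, k⟫_ℝ| ∂κ r))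
  refine ⟨j, ?_⟩
  filter_upwards [hall, ae_timeMeasure_mem_Ioo (D := D)] with t ht htT
  rw [← ENNReal.ofReal_natCast]
  refine lintegral_enorm_inner_le_of_trigAbs fun n => le_trans ?_ hj
  obtain ⟨m, hm⟩ := exists_nat_one_div_lt (sub_pos.2 (max_lt htT.2 hrT.2))
  have h1 := abs_le.1 (ht n m (by linarith [le_max_left t r]))
  have h2 := abs_le.1 (hr n m (by linarith [le_max_right t r]))
  have h3 : ∫ y, trigAbs n ⟪y, k⟫_ℝ ∂κ r ≤ 1 + ∫ y, |⟪y, k⟫_ℝ| ∂κ r := by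
    calc _ ≤ ∫ y, (1 + |⟪y, k⟫_ℝ|) ∂κ r :=
          integral_mono_of_nonneg (Eventually.of_forall fun y => trigAbs_nonneg _ _)
            ((integrable_const _).add hri.abs) (Eventually.of_forall fun y => trigAbs_le _ _)
      _ = _ := by rw [integral_add (integrable_const _) hri.abs]; simp
  linarith

end FPData

end UniformMoments

section Baire

variable {H : Type} [NormedAddCommGroup H] [InnerProductSpace ℝ H] [CompleteSpace H]
  [SecondCountableTopology H] [MeasurableSpace H] [BorelSpace H]

theorem isClosed_setOf_lintegral_enorm_inner_le (ν : Measure H) (M : ℝ≥0∞) :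
    IsClosed {k : H | ∫⁻ y, ‖⟪y, k⟫_ℝ‖ₑ ∂ν ≤ M} := by
  refine IsSeqClosed.isClosed fun x k hx hk => ?_
  calc ∫⁻ y, ‖⟪y, k⟫_ℝ‖ₑ ∂ν = ∫⁻ y, liminf (fun n => ‖⟪y, x n⟫_ℝ‖ₑ) atTop ∂ν := by
        refine lintegral_congr fun y => (Tendsto.liminf_eq ?_).symm
        exact (continuous_enorm.tendsto _).comp (tendsto_const_nhds.inner hk)
    _ ≤ liminf (fun n => ∫⁻ y, ‖⟪y, x n⟫_ℝ‖ₑ ∂ν) atTop :=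
        lintegral_liminf_le fun n => by fun_prop
    _ ≤ M :=
        liminf_le_of_le (by isBoundedDefault) fun b hb => by
          obtain ⟨n, hn⟩ := hb.exists
          exact hn.trans (hx n)

namespace FPData

variable {D : FPData H} {s : ℝ} {ζ : Measure H} [IsProbabilityMeasure ζ]
  {κ : ProbabilityTheory.Kernel ℝ H} [ProbabilityTheory.IsMarkovKernel κ]

theorem isClosed_adjoint_graph : IsClosed (D.A.adjoint.graph : Set (H × H)) :=
  LinearPMap.adjoint_isClosed D.A_dense

theorem exists_ball_lintegral_inner_le (hs : s ∈ Ico 0 D.T)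
    (hd : D.DriftIntegrable (D.spaceTime s κ)) (h : D.PointwiseSol s ζ κ) :
    ∃ ε > 0, ∃ M : ℝ≥0, ∀ᵐ t ∂D.timeMeasure s, ∀ k ∈ D.A.adjoint.graph, ‖k‖ < ε →
      ∫⁻ y, ‖⟪y, k.1⟫_ℝ‖ₑ ∂κ t ≤ M := by
  have : CompleteSpace D.A.adjoint.graph := isClosed_adjoint_graph.completeSpace_coe
  let K (j : ℕ) : Set D.A.adjoint.graph :=
    {k | ∀ᵐ t ∂D.timeMeasure s, ∫⁻ y, ‖⟪y, k.1.1⟫_ℝ‖ₑ ∂κ t ≤ j}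
  have hK (j : ℕ) : IsClosed (K j) := by
    refine IsSeqClosed.isClosed fun x k hx hk => ?_
    filter_upwards [ae_all_iff.2 hx] with t ht
    have hcl := (isClosed_setOf_lintegral_enorm_inner_le (κ t) j).preimage
      (f := fun k : D.A.adjoint.graph => k.1.1) (continuous_fst.comp continuous_subtype_val)
    exact hcl.mem_of_tendsto hk (Eventually.of_forall ht)
  have hU : ⋃ j, K j = univ :=
    iUnion_eq_univ_iff.2 fun k => exists_ae_lintegral_inner_le hs hd h k.2
  obtain ⟨j, k₀, hk₀⟩ := nonempty_interior_of_iUnion_of_closed hK hU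
  obtain ⟨ε, hε, hball⟩ := Metric.isOpen_iff.1 isOpen_interior k₀ hk₀
  have hb : ∀ k ∈ Metric.ball (0 : D.A.adjoint.graph) ε,
      ∀ᵐ t ∂D.timeMeasure s, ∫⁻ y, ‖⟪y, k.1.1⟫_ℝ‖ₑ ∂κ t ≤ (2 * j : ℝ≥0) := by
    intro k hk
    have h1 : k₀ + k ∈ K j := interior_subset (hball (by simpa using hk))
    have h0 : k₀ ∈ K j := interior_subset hk₀
    filter_upwards [h1, h0] with t ht ht₀
    calc ∫⁻ y, ‖⟪y, k.1.1⟫_ℝ‖ₑ ∂κ t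
        ≤ ∫⁻ y, (‖⟪y, (k₀ + k).1.1⟫_ℝ‖ₑ + ‖⟪y, k₀.1.1⟫_ℝ‖ₑ) ∂κ t := by
          refine lintegral_mono fun y => ?_
          have : ⟪y, k.1.1⟫_ℝ = ⟪y, (k₀ + k).1.1⟫_ℝ - ⟪y, k₀.1.1⟫_ℝ := by
            simp [inner_add_right]
          rw [this]
          exact enorm_sub_le
      _ = ∫⁻ y, ‖⟪y, (k₀ + k).1.1⟫_ℝ‖ₑ ∂κ t + ∫⁻ y, ‖⟪y, k₀.1.1⟫_ℝ‖ₑ ∂κ t :=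
          lintegral_add_left (by fun_prop) _
      _ ≤ j + j := add_le_add ht ht₀
      _ = (2 * j : ℝ≥0) := by push_cast; ring
  obtain ⟨S, hS, hSd⟩ := TopologicalSpace.exists_countable_dense D.A.adjoint.graph
  refine ⟨ε, hε, 2 * j, ?_⟩
  have hall := (ae_ball_iff (hS.mono inter_subset_right)).2
    fun k (hk : k ∈ Metric.ball 0 ε ∩ S) => hb k hk.1
  filter_upwards [hall] with t ht k hk hkε
  have hcl : IsClosed {k : D.A.adjoint.graph | ∫⁻ y, ‖⟪y, k.1.1⟫_ℝ‖ₑ ∂κ t ≤ (2 * j : ℝ≥0)} :=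
    (isClosed_setOf_lintegral_enorm_inner_le (κ t) _).preimage
      (continuous_fst.comp continuous_subtype_val)
  exact closure_minimal ht hcl (hSd.open_subset_closure_inter Metric.isOpen_ball
    (show (⟨k, hk⟩ : D.A.adjoint.graph) ∈ Metric.ball 0 ε by simpa using hkε))

theorem CinDAstar.derivWithin_mem_graph {h g : ℝ → H} (hh : D.CinDAstar h g) {t : ℝ}
    (ht : t ∈ Ioo 0 D.T) :
    (derivWithin h (Icc 0 D.T) t, derivWithin g (Icc 0 D.T) t) ∈ D.A.adjoint.graph := by
  have hd := ((hh.1.hasDerivAt_derivWithin_Icc ht).prodMk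
    (hh.2.1.hasDerivAt_derivWithin_Icc ht)).tendsto_slope
  refine isClosed_adjoint_graph.mem_of_tendsto hd ?_
  filter_upwards [nhdsWithin_le_nhds (Icc_mem_nhds ht.1 ht.2)] with r hr
  exact D.A.adjoint.graph.smul_mem _
    (D.A.adjoint.graph.sub_mem (hh.2.2 r hr) (hh.2.2 t (Ioo_subset_Icc_self ht)))

theorem integrable_inner_derivWithin (hs : s ∈ Ico 0 D.T)
    (hd : D.DriftIntegrable (D.spaceTime s κ)) (hsol : D.PointwiseSol s ζ κ) {h g : ℝ → H}
    (hh : D.CinDAstar h g) :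
    Integrable (fun p : ℝ × H => ⟪p.2, derivWithin h (Icc 0 D.T) p.1⟫_ℝ) (D.spaceTime s κ) := by
  have hc := continuousOn_derivWithin hh.1
  obtain ⟨ε, hε, M, hM⟩ := exists_ball_lintegral_inner_le hs hd hsol
  obtain ⟨B, hB⟩ := exists_bound_time (hc.prodMk (continuousOn_derivWithin hh.2.1))
  have hmeas := aestronglyMeasurable_of_continuousOn (continuousOn_inner_time (D := D) hc)
    (ae_spaceTime_mem_Ioo (s := s) (κ := κ) hs.1)
  have hB0 : 0 ≤ B := (norm_nonneg _).trans (hB 0 ⟨le_rfl, D.hT.le⟩)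
  set c : ℝ := ε / (B + 1) with hc_def
  have hc0 : 0 < c := by positivity
  have hbound : ∀ᵐ t ∂D.timeMeasure s,
      ∫⁻ y, ‖⟪y, derivWithin h (Icc 0 D.T) t⟫_ℝ‖ₑ ∂κ t ≤ (‖c⁻¹‖₊ * M : ℝ≥0) := by
    filter_upwards [hM, ae_timeMeasure_mem_Ioo] with t ht htT
    have htI : t ∈ Ioo 0 D.T := ⟨hs.1.trans_lt htT.1, htT.2⟩
    have hlt : ‖c • (derivWithin h (Icc 0 D.T) t, derivWithin g (Icc 0 D.T) t)‖ < ε := by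
      rw [norm_smul, Real.norm_of_nonneg hc0.le]
      calc _ ≤ c * B := mul_le_mul_of_nonneg_left (hB t (Ioo_subset_Icc_self htI)) hc0.le
        _ < c * (B + 1) := mul_lt_mul_of_pos_left (lt_add_one B) hc0
        _ = ε := div_mul_cancel₀ _ (by positivity)
    have h1 := ht _ (D.A.adjoint.graph.smul_mem c (hh.derivWithin_mem_graph htI)) hlt
    have h2 (y : H) : ‖⟪y, derivWithin h (Icc 0 D.T) t⟫_ℝ‖ₑ =
        ‖c⁻¹‖₊ * ‖⟪y, c • derivWithin h (Icc 0 D.T) t⟫_ℝ‖ₑ := by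
      rw [← enorm_eq_nnnorm, ← enorm_mul, inner_smul_right, inv_mul_cancel_left₀ hc0.ne']
    simp_rw [h2]
    rw [lintegral_const_mul' _ _ ENNReal.coe_ne_top, ENNReal.coe_mul]
    exact mul_le_mul_right h1 _
  refine (ProbabilityTheory.integrable_compProd_iff hmeas).2 ⟨?_, ?_⟩
  · filter_upwards [hbound] with t ht
    exact ⟨by fun_prop, ht.trans_lt ENNReal.coe_lt_top⟩
  · refine Integrable.of_bound (aestronglyMeasurable_integral hmeas.norm) (‖c⁻¹‖₊ * M : ℝ≥0) ?_
    filter_upwards [hbound] with t ht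
    rw [Real.norm_of_nonneg (integral_nonneg fun y => norm_nonneg _),
      integral_norm_eq_lintegral_enorm (by fun_prop)]
    exact ENNReal.toReal_le_coe_of_le_coe ht

theorem integrable_Lzero_of_pointwiseSol (hs : s ∈ Ico 0 D.T)
    (hd : D.DriftIntegrable (D.spaceTime s κ)) (h : D.PointwiseSol s ζ κ)
    {u : ℝ × H → ℝ} (hu : u ∈ D.EA) : Integrable (D.Lzero u) (D.spaceTime s κ) :=
  integrable_Lzero (ae_spaceTime_mem_Ioo hs.1) hd
    (fun _ _ hh => integrable_inner_derivWithin hs hd h hh) hu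

theorem pointwiseSol_iff_integratedSol (hs : s ∈ Ico 0 D.T)
    (hd : D.DriftIntegrable (D.spaceTime s κ)) :
    D.PointwiseSol s ζ κ ↔ D.IntegratedSol s ζ κ :=
  ⟨fun h => integratedSol_of_pointwiseSol hs
      (fun _ hu => integrable_Lzero_of_pointwiseSol hs hd h hu) h,
    fun h => pointwiseSol_of_integratedSol hs
      (fun _ hu => integrable_Lzero_of_integratedSol hs h hu) h⟩

end FPData

end Baire

section Kernel

variable {H : Type} [NormedAddCommGroup H] [InnerProductSpace ℝ H] [CompleteSpace H]
  [SecondCountableTopology H] [MeasurableSpace H] [BorelSpace H]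

namespace FPData

variable {D : FPData H} {s : ℝ} {μ : Measure (ℝ × H)} {μt : ℝ → Measure H}

/-- The kernel `(μ_t)`, extended by a Dirac mass outside `[s,T]`. -/
noncomputable def toKernel (hker : D.IsKernel s μ μt) : ProbabilityTheory.Kernel ℝ H where
  toFun t := if t ∈ Icc s D.T then μt t else Measure.dirac 0
  measurable' := (Measure.measurable_of_measurable_coe _ hker.1).ite measurableSet_Icc
    measurable_const

theorem toKernel_apply (hker : D.IsKernel s μ μt) {t : ℝ} (ht : t ∈ Icc s D.T) :
    toKernel hker t = μt t :=
  if_pos ht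

theorem isMarkovKernel_toKernel (hker : D.IsKernel s μ μt)
    (hprob : ∀ t ∈ Icc s D.T, IsProbabilityMeasure (μt t)) :
    ProbabilityTheory.IsMarkovKernel (toKernel hker) := by
  refine ⟨fun t => ?_⟩
  by_cases ht : t ∈ Icc s D.T
  · rw [toKernel_apply hker ht]
    exact hprob t ht
  · have : toKernel hker t = Measure.dirac 0 := if_neg ht
    rw [this]
    infer_instance

theorem spaceTime_toKernel (hker : D.IsKernel s μ μt)
    [ProbabilityTheory.IsMarkovKernel (toKernel hker)] :
    D.spaceTime s (toKernel hker) = μ := by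
  ext E hE
  rw [Measure.compProd_apply hE, hker.2 E hE]
  refine setLIntegral_congr_fun measurableSet_Icc fun t ht => ?_
  rw [toKernel_apply hker ht]
  rfl

theorem pointwiseSol_toKernel_iff (hker : D.IsKernel s μ μt) {ζ : Measure H} :
    D.PointwiseSol s ζ (toKernel hker) ↔
      ∀ u ∈ D.EA, ∀ᵐ t ∂D.timeMeasure s, ∫ y, u (t, y) ∂(μt t) =
        ∫ y, u (s, y) ∂ζ + ∫ r in Icc s t, (∫ y, D.Lzero u (r, y) ∂(μt r)) := by
  refine forall₂_congr fun u _ => eventually_congr ?_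
  filter_upwards [ae_timeMeasure_mem_Icc] with t ht
  rw [toKernel_apply hker ht, setIntegral_congr_fun (measurableSet_Icc (a := s) (b := t))
    fun r hr => by rw [toKernel_apply hker ⟨hr.1, hr.2.trans ht.2⟩]]

end FPData

end Kernel

section Theorems

open MeasureTheory Set Filter Topology
open scoped InnerProductSpace ENNReal NNReal

variable {H : Type} [NormedAddCommGroup H] [InnerProductSpace ℝ H] [CompleteSpace H]
  [SecondCountableTopology H] [MeasurableSpace H] [BorelSpace H]

/-- Remark 1.1(ii): equivalence of the two formulations (1.5) and (1.8)
of the Fokker–Planck equation. -/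
theorem statement2 (D : FPData H) (s : ℝ) (hs : s ∈ Icc 0 D.T)
    (ζ : Measure H) [IsProbabilityMeasure ζ]
    (μ : Measure (ℝ × H)) (μt : ℝ → Measure H)
    (hprob : ∀ t ∈ Icc s D.T, IsProbabilityMeasure (μt t))
    (hker : D.IsKernel s μ μt) (hdrift : D.DriftIntegrable μ) :
    (∀ u ∈ D.EA, ∀ᵐ t ∂(volume.restrict (Icc s D.T)),
        ∫ y, u (t, y) ∂(μt t) =
          ∫ y, u (s, y) ∂ζ + ∫ r in Icc s t, (∫ y, D.Lzero u (r, y) ∂(μt r))) ↔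
      (∀ u ∈ D.EA, ∫ p, D.Lzero u p ∂μ = -∫ y, u (s, y) ∂ζ) := by
  have := FPData.isMarkovKernel_toKernel hker hprob
  have hμ := FPData.spaceTime_toKernel hker
  rw [← FPData.pointwiseSol_toKernel_iff hker]
  rcases hs.2.lt_or_eq with hlt | rfl
  · rw [FPData.pointwiseSol_iff_integratedSol ⟨hs.1, hlt⟩ (by rwa [hμ]), FPData.IntegratedSol, hμ]
  · have hρ : D.timeMeasure D.T = 0 := by simp [FPData.timeMeasure]
    have hμ0 : μ = 0 := by rw [← hμ, FPData.spaceTime, hρ, Measure.compProd_zero_left]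
    refine iff_of_true (fun u _ => by rw [hρ]; simp) fun u hu => ?_
    obtain ⟨ω, -, hω0, hω⟩ := FPData.EA_bound hu
    have hu0 (y : H) : u (D.T, y) = 0 := abs_nonpos_iff.1 ((hω (D.T, y)).trans_eq hω0)
    simp [hμ0, hu0]

end Theorems
end
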